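/- arXiv:1912.07147 — 3 statements merged into one kernel-verified Lean document; each statement's English description precedes it below -/
import Mathlib

section
/- For every ε > 0 there exists N such that for all n ≥ N, (1 − ε)·n·log₂ n ≤ t₂(n,2) ≤ (1 + ε)·n·log₂ n; that is, t₂(n,2) = (1 + o(1))·n·log₂ n. -/
open SimpleGraph

/-- A walk is rainbow (w.r.t. an edge-colouring `col`) if its edges receive
pairwise distinct colours. -/
def IsRainbowWalk {V α : Type*} {G : SimpleGraph V} {u v : V} (col : Sym2 V → α)
    (p : G.Walk u v) : Prop :=
  (p.edges.map col).Nodup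

/-- An edge-colouring is rainbow 2-connected if every two distinct vertices are
connected by two internally vertex-disjoint rainbow paths. -/
def RainbowTwoConnectedColouring {V α : Type*} (G : SimpleGraph V) (col : Sym2 V → α) : Prop :=
  ∀ u v : V, u ≠ v → ∃ p q : G.Walk u v, p.IsPath ∧ q.IsPath ∧ p ≠ q ∧
    IsRainbowWalk col p ∧ IsRainbowWalk col q ∧
    ∀ w : V, w ∈ p.support → w ∈ q.support → w = u ∨ w = v

/-- The rainbow 2-connection number: the least number of colours in a rainbow
2-connected colouring. -/
noncomputable def rc2 {V : Type*} (G : SimpleGraph V) : ℕ :=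
  sInf {r : ℕ | ∃ col : Sym2 V → Fin r, RainbowTwoConnectedColouring G col}

/-- A graph is 2-connected if it has at least 3 vertices and deleting any single
vertex leaves a connected graph. -/
def TwoConnected {V : Type*} [Fintype V] (G : SimpleGraph V) : Prop :=
  3 ≤ Fintype.card V ∧ ∀ v : V, (G.induce ({v}ᶜ : Set V)).Connected

/-- `t2 n r`: minimum number of edges of a 2-connected graph on `n` vertices
with rainbow 2-connection number at most `r`. -/
noncomputable def t2 (n r : ℕ) : ℕ :=
  sInf {m : ℕ | ∃ G : SimpleGraph (Fin n), TwoConnected G ∧ rc2 G ≤ r ∧ G.edgeSet.ncard = m}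

/-- `s2 n r`: maximum number of edges of a 2-connected graph on `n` vertices
with rainbow 2-connection number at least `r`. -/
noncomputable def s2 (n r : ℕ) : ℕ :=
  sSup {m : ℕ | ∃ G : SimpleGraph (Fin n), TwoConnected G ∧ r ≤ rc2 G ∧ G.edgeSet.ncard = m}

/-- If a walk meets a set `A`, then it has a suffix meeting `A` in its first vertex only. -/
theorem SimpleGraph.Walk.exists_suffix_inter_eq_start {V : Type*} {G : SimpleGraph V}
    (A : Set V) {a v : V} (r : G.Walk a v) (hr : ∃ y ∈ r.support, y ∈ A) :
    ∃ x ∈ A, ∃ s : G.Walk x v, s.support ⊆ r.support ∧ ∀ y ∈ s.support, y ∈ A → y = x := by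
  induction r with
  | @nil a =>
    obtain ⟨y, hy, hyA⟩ := hr
    obtain rfl : y = a := by simpa using hy
    exact ⟨y, hyA, .nil, by simp, by simp⟩
  | @cons a b c h r ih =>
    by_cases hA : ∃ y ∈ r.support, y ∈ A
    · obtain ⟨x, hx, s, hs, hs'⟩ := ih hA
      exact ⟨x, hx, s, fun z hz => by simp [hs hz], hs'⟩
    · push Not at hA
      obtain ⟨y, hy, hyA⟩ := hr
      rw [Walk.support_cons, List.mem_cons] at hy
      obtain rfl := hy.resolve_right fun h => hA y h hyA
      refine ⟨y, hyA, .cons h r, by simp, fun z hz hzA => ?_⟩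
      rw [Walk.support_cons, List.mem_cons] at hz
      exact hz.resolve_right fun h => hA z h hzA

theorem TwoConnected.exists_walk_avoiding {V : Type*} [Fintype V] {G : SimpleGraph V}
    (hG : TwoConnected G) {u v w : V} (hu : u ≠ w) (hv : v ≠ w) :
    ∃ r : G.Walk u v, w ∉ r.support := by
  obtain ⟨r⟩ := (hG.2 w).preconnected ⟨u, by simpa using hu⟩ ⟨v, by simpa using hv⟩
  refine ⟨r.map (Embedding.induce _).toHom, fun hw => ?_⟩
  have hw' : w ∈ r.support.map (Embedding.induce (G := G) ({w}ᶜ : Set V)).toHom := by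
    rw [← Walk.support_map]
    exact hw
  obtain ⟨x, -, hx⟩ := List.mem_map.1 hw'
  exact x.2 hx

/-- One step of Whitney's argument: two walks from `u` to `w` meeting only in their ends yield
two such walks from `u` to a neighbour `v` of `w`. -/
theorem TwoConnected.exists_disjoint_walks_step {V : Type*} [Fintype V] {G : SimpleGraph V}
    (hG : TwoConnected G) {u v w : V} (huw : u ≠ w) (hwv : G.Adj w v) {p q : G.Walk u w}
    (hp : p.IsPath) (hq : q.IsPath) (hpq : ∀ x ∈ p.support, x ∈ q.support → x = u ∨ x = w) :
    ∃ p q : G.Walk u v, ∀ x ∈ p.support, x ∈ q.support → x = u ∨ x = v := by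
  classical
  obtain ⟨r, hr⟩ := hG.exists_walk_avoiding huw hwv.ne'
  obtain ⟨x, hx, s, hs, hs'⟩ := r.exists_suffix_inter_eq_start
    {y | y ∈ p.support ∨ y ∈ q.support} ⟨u, by simp, by simp⟩
  have hxw : x ≠ w := by rintro rfl; exact hr (hs (by simp))
  wlog hxp : x ∈ p.support generalizing p q
  · exact this hq hp (fun y hy hy' => hpq y hy' hy) (Or.symm hx)
      (fun y hy hy' => hs' y hy (Or.symm hy')) (hx.resolve_left hxp)
  refine ⟨(p.takeUntil x hxp).append s, q.concat hwv, fun y hy hy' => ?_⟩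
  rw [Walk.support_concat, List.mem_append, List.mem_singleton] at hy'
  rw [Walk.mem_support_append_iff] at hy
  rcases hy' with hy' | hy'
  · have hyp : y ∈ p.support := by
      rcases hy with hy | hy
      · exact p.support_takeUntil_subset_support hxp hy
      · rwa [hs' y hy (Or.inr hy')]
    refine (hpq y hyp hy').imp_right fun hyw => ?_
    subst hyw
    rcases hy with hy | hy
    · exact absurd hy (Walk.endpoint_notMem_support_takeUntil hp hxp hxw.symm)
    · exact absurd (hs hy) hr
  · exact Or.inr hy'

theorem TwoConnected.exists_ne_ne {V : Type*} [Fintype V] {G : SimpleGraph V}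
    (hG : TwoConnected G) (u v : V) : ∃ w, w ≠ u ∧ w ≠ v := by
  classical
  obtain ⟨w, hw⟩ := Finset.exists_mem_notMem_of_card_lt_card
    (s := {u, v}) (t := Finset.univ) (Finset.card_le_two.trans_lt hG.1)
  exact ⟨w, by simpa using hw⟩

theorem TwoConnected.exists_disjoint_walks {V : Type*} [Fintype V] {G : SimpleGraph V}
    (hG : TwoConnected G) (u v : V) :
    ∃ p q : G.Walk u v, ∀ x ∈ p.support, x ∈ q.support → x = u ∨ x = v := by
  classical
  have hconn : G.Preconnected := by
    intro a b
    obtain ⟨c, hca, hcb⟩ := hG.exists_ne_ne a b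
    exact ⟨(hG.exists_walk_avoiding hca.symm hcb.symm).choose⟩
  obtain ⟨r⟩ := hconn u v
  induction r using Walk.concatRec with
  | Hnil => exact ⟨.nil, .nil, by simp⟩
  | @Hconcat u w v r h ih =>
    obtain ⟨p, q, hpq⟩ := ih
    by_cases huw : u = w
    · subst huw
      exact ⟨h.toWalk, h.toWalk, by simp⟩
    · exact hG.exists_disjoint_walks_step huw h p.bypass_isPath q.bypass_isPath fun x hx hx' =>
        hpq x (p.support_bypass_subset_support hx) (q.support_bypass_subset_support hx')

/-- Whitney's theorem: any two vertices of a 2-connected graph are joined by two internally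
disjoint paths. -/
theorem TwoConnected.exists_disjoint_paths {V : Type*} [Fintype V] {G : SimpleGraph V}
    (hG : TwoConnected G) {u v : V} (huv : u ≠ v) :
    ∃ p q : G.Walk u v, p.IsPath ∧ q.IsPath ∧ p ≠ q ∧
      ∀ x ∈ p.support, x ∈ q.support → x = u ∨ x = v := by
  classical
  suffices ∃ p q : G.Walk u v, s(u, v) ∉ q.edges ∧
      ∀ x ∈ p.support, x ∈ q.support → x = u ∨ x = v by
    obtain ⟨p, q, hq, hpq⟩ := this
    have hpq' : ∀ x ∈ p.bypass.support, x ∈ q.bypass.support → x = u ∨ x = v := fun x hx hx' =>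
      hpq x (p.support_bypass_subset_support hx) (q.support_bypass_subset_support hx')
    refine ⟨p.bypass, q.bypass, p.bypass_isPath, q.bypass_isPath, fun h => ?_, hpq'⟩
    rw [h] at hpq'
    have hq' : s(u, v) ∉ q.bypass.edges := fun h => hq (q.edges_bypass_subset_edges h)
    generalize q.bypass = r at hpq' hq'
    cases r with
    | nil => exact huv rfl
    | @cons _ b _ h r =>
      obtain rfl | rfl := hpq' b (by simp) (by simp)
      · exact h.ne rfl
      · simp at hq'
  by_cases h : G.Adj u v
  · obtain ⟨t, ht⟩ := hG.exists_ne_ne u v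
    obtain ⟨r, hr⟩ := hG.exists_walk_avoiding huv ht.2
    obtain ⟨s, hs⟩ := hG.exists_walk_avoiding ht.1 huv.symm
    refine ⟨h.toWalk, r.append s, fun he => ?_, by simp⟩
    rw [Walk.edges_append, List.mem_append] at he
    exact he.elim (fun he => hr (r.snd_mem_support_of_mem_edges he))
      fun he => hs (s.fst_mem_support_of_mem_edges he)
  · obtain ⟨p, q, hpq⟩ := hG.exists_disjoint_walks u v
    exact ⟨p, q, fun he => h (q.adj_of_mem_edges he), hpq⟩

theorem TwoConnected.exists_rainbowTwoConnectedColouring_rc2 {V : Type*} [Fintype V]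
    {G : SimpleGraph V} (hG : TwoConnected G) :
    ∃ col : Sym2 V → Fin (rc2 G), RainbowTwoConnectedColouring G col := by
  classical
  refine Nat.sInf_mem (s := {r | ∃ col : Sym2 V → Fin r, RainbowTwoConnectedColouring G col})
    ⟨Fintype.card (Sym2 V), Fintype.equivFin _, fun u v huv => ?_⟩
  obtain ⟨p, q, hp, hq, hne, hpq⟩ := hG.exists_disjoint_paths huv
  exact ⟨p, q, hp, hq, hne, hp.isTrail.edges_nodup.map (Fintype.equivFin _).injective,
    hq.isTrail.edges_nodup.map (Fintype.equivFin _).injective, hpq⟩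

/-- `u - w - v` is a path of length two in `G` whose two edges get different colours. -/
def IsRainbowCherry {V α : Type*} (G : SimpleGraph V) (col : Sym2 V → α) (u w v : V) : Prop :=
  G.Adj u w ∧ G.Adj w v ∧ col s(u, w) ≠ col s(w, v)

theorem IsRainbowWalk.length_le {V : Type*} {G : SimpleGraph V} {r : ℕ} {col : Sym2 V → Fin r}
    {u v : V} {p : G.Walk u v} (hp : IsRainbowWalk col p) : p.length ≤ r := by
  simpa using List.Nodup.length_le_card hp

theorem RainbowTwoConnectedColouring.exists_isRainbowCherry {V : Type*} {G : SimpleGraph V}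
    {r : ℕ} (hr : r ≤ 2) {col : Sym2 V → Fin r} (h : RainbowTwoConnectedColouring G col)
    {u v : V} (huv : u ≠ v) : ∃ w, IsRainbowCherry G col u w v := by
  have key : ∀ p : G.Walk u v, IsRainbowWalk col p →
      (∃ w, IsRainbowCherry G col u w v) ∨ p.support = [u, v] := by
    intro p hp
    have hlen := hp.length_le.trans hr
    match p, hp, hlen with
    | .nil, _, _ => exact absurd rfl huv
    | .cons _ .nil, _, _ => exact Or.inr (by simp)
    | .cons h₁ (.cons h₂ .nil), hp, _ =>
      exact Or.inl ⟨_, h₁, h₂, by simpa [IsRainbowWalk] using hp⟩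
    | .cons _ (.cons _ (.cons _ p)), _, hlen =>
      simp only [Walk.length_cons] at hlen
      omega
  obtain ⟨p, q, -, -, hne, hp, hq, -⟩ := h u v huv
  rcases key p hp with hp | hp
  · exact hp
  rcases key q hq with hq | hq
  · exact hq
  exact absurd (Walk.ext_support (hp.trans hq.symm)) hne

/-- Every pair of vertices is joined by an edge and a rainbow cherry, or by two rainbow
cherries. -/
def HasRainbowCherries {V α : Type*} (G : SimpleGraph V) (col : Sym2 V → α) : Prop :=
  ∀ u v : V, u ≠ v → ∃ w, IsRainbowCherry G col u w v ∧
    (G.Adj u v ∨ ∃ w', w' ≠ w ∧ IsRainbowCherry G col u w' v)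

theorem HasRainbowCherries.rainbowTwoConnectedColouring {V α : Type*} {G : SimpleGraph V}
    {col : Sym2 V → α} (h : HasRainbowCherries G col) : RainbowTwoConnectedColouring G col := by
  intro u v huv
  obtain ⟨w, ⟨h₁, h₂, hc⟩, h₃ | ⟨w', hw, h₃, h₄, hc'⟩⟩ := h u v huv
  · refine ⟨.cons h₁ (.cons h₂ .nil), .cons h₃ .nil, ?_, ?_, ?_, ?_, ?_, ?_⟩ <;>
      simp_all [IsRainbowWalk, h₁.ne, h₂.ne]
  · refine ⟨.cons h₁ (.cons h₂ .nil), .cons h₃ (.cons h₄ .nil), ?_, ?_, ?_, ?_, ?_, ?_⟩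
    · simp [h₁.ne, h₂.ne, huv]
    · simp [h₃.ne, h₄.ne, huv]
    · intro h
      have := congrArg Walk.support h
      simp at this
      exact hw this.symm
    · simpa [IsRainbowWalk] using hc
    · simpa [IsRainbowWalk] using hc'
    · intro x hx hx'
      simp only [Walk.support_cons, Walk.support_nil, List.mem_cons, List.not_mem_nil,
        or_false] at hx hx'
      grind

theorem HasRainbowCherries.rc2_le_two {V : Type*} {G : SimpleGraph V}
    {col : Sym2 V → Fin 2} (h : HasRainbowCherries G col) : rc2 G ≤ 2 :=
  Nat.sInf_le ⟨col, h.rainbowTwoConnectedColouring⟩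

theorem HasRainbowCherries.twoConnected {V α : Type*} [Fintype V] {G : SimpleGraph V}
    {col : Sym2 V → α} (h : HasRainbowCherries G col) (hV : 3 ≤ Fintype.card V) :
    TwoConnected G := by
  refine ⟨hV, fun x => ?_⟩
  have : Nonempty ({x}ᶜ : Set V) := by
    have := Fintype.one_lt_card_iff_nontrivial.1 (by omega : 1 < Fintype.card V)
    obtain ⟨y, hy⟩ := exists_ne x
    exact ⟨⟨y, hy⟩⟩
  refine ⟨fun ⟨u, hu⟩ ⟨v, hv⟩ => ?_⟩
  obtain rfl | huv := eq_or_ne u v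
  · rfl
  have key : ∀ w, w ≠ x → IsRainbowCherry G col u w v →
      (G.induce ({x}ᶜ : Set V)).Reachable ⟨u, hu⟩ ⟨v, hv⟩ := fun w hw hc =>
    (Adj.reachable (v := (⟨w, hw⟩ : ({x}ᶜ : Set V))) hc.1).trans
      (Adj.reachable (u := (⟨w, hw⟩ : ({x}ᶜ : Set V))) hc.2.1)
  obtain ⟨w, hc, hadj | ⟨w', hw, hc'⟩⟩ := h u v huv
  · exact Adj.reachable (G := G.induce _) (u := ⟨u, hu⟩) (v := ⟨v, hv⟩) hadj
  · by_cases hwx : w = x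
    · exact key w' (hwx ▸ hw) hc'
    · exact key w hwx hc

/-- Transport of a graph along an equivalence of its vertex set preserves
`HasRainbowCherries`. -/
theorem HasRainbowCherries.comap {V W α : Type*} {G : SimpleGraph V} {col : Sym2 V → α}
    (h : HasRainbowCherries G col) (e : W ≃ V) :
    HasRainbowCherries (G.comap e) (col ∘ Sym2.map e) := by
  intro u v huv
  obtain ⟨w, hc, hw⟩ := h (e u) (e v) (e.injective.ne huv)
  refine ⟨e.symm w, by simpa [IsRainbowCherry] using hc, hw.imp id ?_⟩
  rintro ⟨w', hne, hc'⟩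
  exact ⟨e.symm w', by simpa using hne, by simpa [IsRainbowCherry] using hc'⟩

theorem IsRainbowCherry.symm {V α : Type*} {G : SimpleGraph V} {col : Sym2 V → α} {u w v : V}
    (h : IsRainbowCherry G col u w v) : IsRainbowCherry G col v w u :=
  ⟨h.2.1.symm, h.1.symm, by
    rw [Sym2.eq_swap (a := v), Sym2.eq_swap (a := w) (b := u)]
    exact h.2.2.symm⟩

namespace HubGraph

/-- The coordinates of a code word: the `inr i` are its bits, `inl 2` is its parity, and `inl 0`,
`inl 1` are constantly zero. -/
abbrev Hub (k : ℕ) : Type := Fin 3 ⊕ Fin k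

open Classical in
/-- The extended code word of a set of coordinates. -/
noncomputable def code {k : ℕ} (x : Finset (Fin k)) : Hub k → Fin 2
  | .inl j => if j = 2 ∧ Odd x.card then 1 else 0
  | .inr i => if i ∈ x then 1 else 0

/-- The colouring of the edges between hubs: only the edge between `inl 0` and `inl 2` has
colour `0`. -/
def hubColour {k : ℕ} (g h : Hub k) : Fin 2 :=
  if (g = .inl 0 ∧ h = .inl 2) ∨ (g = .inl 2 ∧ h = .inl 0) then 0 else 1

/-- The graph on the code words `S` and the hubs in which all pairs are adjacent except for those
of two code words. -/
def graph {k : ℕ} (S : Finset (Finset (Fin k))) : SimpleGraph (S ⊕ Hub k) where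
  Adj a b := a ≠ b ∧ (a.isRight ∨ b.isRight)
  symm := ⟨fun _ _ h => ⟨h.1.symm, h.2.symm⟩⟩
  loopless := ⟨fun _ h => h.1 rfl⟩

/-- The colour of a pair of vertices of the hub graph. -/
noncomputable def pairColour {k : ℕ} {S : Finset (Finset (Fin k))} :
    S ⊕ Hub k → S ⊕ Hub k → Fin 2
  | .inl _, .inl _ => 0
  | .inl x, .inr h => code x.1 h
  | .inr h, .inl x => code x.1 h
  | .inr g, .inr h => hubColour g h

/-- The edge-colouring of the hub graph. -/
noncomputable def colour {k : ℕ} (S : Finset (Finset (Fin k))) : Sym2 (S ⊕ Hub k) → Fin 2 :=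
  Sym2.lift ⟨pairColour, by
    rintro (x | g) (y | h) <;> simp only [pairColour, hubColour]
    simp only [and_comm, or_comm]⟩

variable {k : ℕ} {S : Finset (Finset (Fin k))}

theorem exists_two_code_ne {x y : Finset (Fin k)} (hxy : x ≠ y) :
    ∃ g h : Hub k, g ≠ h ∧ code x g ≠ code y g ∧ code x h ≠ code y h := by
  obtain ⟨i, hi⟩ : ∃ i, ¬(i ∈ x ↔ i ∈ y) := by
    by_contra! h
    exact hxy (Finset.ext h)
  by_cases hj : ∃ j, j ≠ i ∧ ¬(j ∈ x ↔ j ∈ y)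
  · obtain ⟨j, hji, hj⟩ := hj
    refine ⟨.inr i, .inr j, by simpa using hji.symm, ?_, ?_⟩ <;> simp only [code] <;> grind
  · push Not at hj
    refine ⟨.inr i, .inl 2, by simp, by simp only [code]; grind, ?_⟩
    have key : ∀ x y : Finset (Fin k), i ∈ x → i ∉ y → (∀ j, j ≠ i → (j ∈ x ↔ j ∈ y)) →
        x.card = y.card + 1 := by
      intro x y hx hy h
      rw [← Finset.card_insert_of_notMem hy]
      congr 1
      ext j
      by_cases hji : j = i
      · simp [hji, hx]
      · simp [hji, h j hji]
    by_cases hx : i ∈ x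
    · have := key x y hx (by tauto) hj
      simp only [code]
      grind
    · have := key y x (by tauto) hx fun j h => (hj j h).symm
      simp only [code]
      grind

theorem exists_isRainbowCherry_hub_hub (hk : 0 < k) (hS : ∀ i : Fin k, {i} ∈ S) {g h : Hub k}
    (hgh : g ≠ h) : ∃ w, IsRainbowCherry (graph S) (colour S) (.inr g) w (.inr h) := by
  have viaWord : ∀ (i : Fin k) (g h : Hub k), code {i} g ≠ code {i} h →
      IsRainbowCherry (graph S) (colour S) (.inr g) (.inl ⟨{i}, hS i⟩) (.inr h) := fun i g h hc =>
    ⟨by simp [graph], by simp [graph], hc⟩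
  have viaHub : ∀ w g h : Hub k, g ≠ w → w ≠ h → hubColour g w ≠ hubColour w h →
      IsRainbowCherry (graph S) (colour S) (.inr g) (.inr w) (.inr h) := fun w g h h₁ h₂ hc =>
    ⟨by simp [graph, h₁], by simp [graph, h₂], hc⟩
  have h01 := viaHub (.inl 2) (.inl 0) (.inl 1) (by simp) (by simp) (by simp [hubColour])
  have h02 := viaWord ⟨0, hk⟩ (.inl 0) (.inl 2) (by simp [code])
  have h12 := viaHub (.inl 0) (.inl 1) (.inl 2) (by simp) (by simp) (by simp [hubColour])
  have hbit : ∀ (j : Fin 3) (i : Fin k),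
      ∃ w, IsRainbowCherry (graph S) (colour S) (.inr (.inl j)) w (.inr (.inr i)) := by
    intro j i
    fin_cases j
    · exact ⟨_, viaHub (.inl 2) _ _ (by simp) (by simp) (by simp [hubColour])⟩
    · exact ⟨_, viaWord i _ _ (by simp [code])⟩
    · exact ⟨_, viaHub (.inl 0) _ _ (by simp) (by simp) (by simp [hubColour])⟩
  rcases g with g | i <;> rcases h with h | j
  · fin_cases g <;> fin_cases h <;>
      first
        | exact absurd rfl hgh
        | exact ⟨_, h01⟩
        | exact ⟨_, h02⟩
        | exact ⟨_, h12⟩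
        | exact ⟨_, h01.symm⟩
        | exact ⟨_, h02.symm⟩
        | exact ⟨_, h12.symm⟩
  · exact hbit _ _
  · exact (hbit _ _).imp fun _ => IsRainbowCherry.symm
  · have hij : i ≠ j := fun h => hgh (h ▸ rfl)
    exact ⟨_, viaWord i _ _ (by simp [code, hij.symm])⟩

theorem exists_isRainbowCherry_hub_word (g : Hub k) (x : S) :
    ∃ w, IsRainbowCherry (graph S) (colour S) (.inr g) w (.inl x) := by
  by_cases hg : g = .inl 1
  · subst hg
    exact ⟨.inr (.inl 0), by simp [graph], by simp [graph],
      by simp [colour, pairColour, hubColour, code]⟩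
  · exact ⟨.inr (.inl 1), by simp [graph, hg], by simp [graph],
      by simp [colour, pairColour, hubColour, code]⟩

theorem hasRainbowCherries (hk : 0 < k) (hS : ∀ i : Fin k, {i} ∈ S) :
    HasRainbowCherries (graph S) (colour S) := by
  rintro (x | g) (y | h) huv
  · obtain ⟨g, h, hgh, hg, hh⟩ := exists_two_code_ne (x := x.1) (y := y.1)
      fun h => huv (congrArg _ (Subtype.ext h))
    exact ⟨.inr g, ⟨by simp [graph], by simp [graph], hg⟩,
      Or.inr ⟨.inr h, by simpa using hgh.symm, by simp [graph], by simp [graph], hh⟩⟩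
  · exact (exists_isRainbowCherry_hub_word h x).imp fun _ hw => ⟨hw.symm, Or.inl (by simp [graph])⟩
  · exact (exists_isRainbowCherry_hub_word g y).imp fun _ hw => ⟨hw, Or.inl (by simp [graph])⟩
  · exact (exists_isRainbowCherry_hub_hub hk hS fun h => huv (congrArg _ h)).imp
      fun _ hw => ⟨hw, Or.inl (by simpa [graph] using huv)⟩

theorem ncard_edgeSet_le : (graph S).edgeSet.ncard ≤ (k + 3) * (S.card + (k + 3)) := by
  classical
  let f : Hub k × (S ⊕ Hub k) → Sym2 (S ⊕ Hub k) := fun p => s(.inr p.1, p.2)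
  have hsub : (graph S).edgeSet ⊆ (Finset.univ.image f : Finset _) := by
    rintro ⟨a, b⟩ ⟨-, hab⟩
    simp only [Finset.coe_image, Finset.coe_univ, Set.image_univ, Set.mem_range, Prod.exists, f]
    rcases a with x | g
    · rcases b with y | h
      · simp at hab
      · exact ⟨h, .inl x, Sym2.eq_swap⟩
    · exact ⟨g, b, rfl⟩
  calc (graph S).edgeSet.ncard ≤ (Finset.univ.image f).card := by
        rw [← Set.ncard_coe_finset]
        exact Set.ncard_le_ncard hsub (Finset.finite_toSet _)
    _ ≤ _ := Finset.card_image_le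
    _ = _ := by simp [add_comm]

end HubGraph

theorem exists_graph_of_le_two_pow {n k : ℕ} (hk : 0 < k) (h₁ : 2 * k + 3 ≤ n) (h₂ : n ≤ 2 ^ k) :
    ∃ G : SimpleGraph (Fin n), TwoConnected G ∧ rc2 G ≤ 2 ∧ G.edgeSet.ncard ≤ (k + 3) * n := by
  classical
  let T : Finset (Finset (Fin k)) := Finset.univ.image fun i => {i}
  have hT : T.card ≤ n - (k + 3) := Finset.card_image_le.trans (by simp; omega)
  obtain ⟨S, hTS, -, hS⟩ := Finset.exists_subsuperset_card_eq (Finset.subset_univ T) hT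
    (by simp; omega)
  have hcard : Fintype.card (S ⊕ HubGraph.Hub k) = n := by simp [hS]; omega
  let e : Fin n ≃ S ⊕ HubGraph.Hub k := (Fintype.equivFinOfCardEq hcard).symm
  have h := (HubGraph.hasRainbowCherries hk (S := S)
    fun i => hTS (Finset.mem_image_of_mem _ (Finset.mem_univ i))).comap e
  refine ⟨_, h.twoConnected (by simp; omega), h.rc2_le_two, ?_⟩
  have hiso := Nat.card_congr (Iso.comap e (HubGraph.graph S)).mapEdgeSet
  rw [Nat.card_coe_set_eq, Nat.card_coe_set_eq] at hiso
  rw [hiso]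
  refine HubGraph.ncard_edgeSet_le.trans_eq ?_
  rw [hS]
  congr 1
  omega

/-- A convexity bound behind Hansel's lemma: if `∑ 2 ^ (-d x)` is at most `K`, then the `d x` are
at least `log₂ (|L| / K)` on average. -/
theorem card_mul_logb_le_sum {ι : Type*} (L : Finset ι) (hL : L.Nonempty) (d : ι → ℕ) {K : ℝ}
    (hK : 0 < K) (h : ∑ x ∈ L, (2 : ℝ)⁻¹ ^ d x ≤ K) :
    L.card * Real.logb 2 (L.card / K) ≤ ∑ x ∈ L, (d x : ℝ) := by
  have hm : (0 : ℝ) < L.card := by exact_mod_cast hL.card_pos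
  have hlog : 0 < Real.log 2 := Real.log_pos one_lt_two
  set t := Real.logb 2 (L.card / K) with ht
  have ht' : Real.exp (Real.log 2 * t) = L.card / K := by
    rw [ht, Real.logb, mul_div_cancel₀ _ hlog.ne', Real.exp_log (by positivity)]
  have key : ∀ x ∈ L, 1 - Real.log 2 * (d x - t) ≤ L.card / K * (2 : ℝ)⁻¹ ^ d x := by
    intro x _
    have h1 : L.card / K * (2 : ℝ)⁻¹ ^ d x = Real.exp (-(Real.log 2 * (d x - t))) := by
      rw [← ht', ← Real.exp_log (show (0 : ℝ) < 2⁻¹ ^ d x by positivity), ← Real.exp_add,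
        Real.log_pow, Real.log_inv]
      ring_nf
    rw [h1]
    linarith [Real.add_one_le_exp (-(Real.log 2 * (d x - t)))]
  have h2 := Finset.sum_le_sum key
  rw [← Finset.mul_sum] at h2
  have h3 : L.card / K * ∑ x ∈ L, (2 : ℝ)⁻¹ ^ d x ≤ L.card := by
    calc _ ≤ L.card / K * K := by gcongr
      _ = L.card := by field_simp
  simp only [Finset.sum_sub_distrib, ← Finset.mul_sum, Finset.sum_const, nsmul_eq_mul,
    mul_one] at h2
  by_contra! hlt
  nlinarith [mul_pos hlog (sub_pos.2 hlt)]

section LowerBound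

variable {V : Type*} [Fintype V] [DecidableEq V] {G : SimpleGraph V} [DecidableRel G.Adj]

/-- The vertices of degree at most `D`. -/
def SimpleGraph.lowVerts (G : SimpleGraph V) [DecidableRel G.Adj] (D : ℕ) : Finset V :=
  {x | G.degree x ≤ D}

/-- The neighbours of `x` of degree greater than `D`. -/
def SimpleGraph.highNbrs (G : SimpleGraph V) [DecidableRel G.Adj] (D : ℕ) (x : V) : Finset V :=
  {h ∈ G.neighborFinset x | D < G.degree h}

theorem SimpleGraph.sum_card_highNbrs_le (D : ℕ) :
    ∑ x ∈ G.lowVerts D, (G.highNbrs D x).card ≤ G.edgeFinset.card := by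
  rw [← Finset.card_sigma]
  refine Finset.card_le_card_of_injOn (fun p => s(p.1, p.2)) ?_ ?_
  · rintro ⟨x, h⟩ hp
    simp [lowVerts, highNbrs] at hp
    simpa using hp.2.1
  · rintro ⟨x, h⟩ hp ⟨y, g⟩ hq hpq
    simp [lowVerts, highNbrs] at hp hq
    simp only [Sym2.eq_iff] at hpq
    rcases hpq with ⟨rfl, rfl⟩ | ⟨rfl, rfl⟩
    · rfl
    · omega

theorem SimpleGraph.mul_card_sub_card_lowVerts_le (D : ℕ) :
    D * (Fintype.card V - (G.lowVerts D).card) ≤ 2 * G.edgeFinset.card := by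
  rw [← Finset.card_compl, ← G.sum_degrees_eq_twice_card_edges, mul_comm, ← smul_eq_mul]
  refine (Finset.card_nsmul_le_sum _ _ _ fun x hx => ?_).trans
    (Finset.sum_le_sum_of_subset (Finset.subset_univ _))
  simp [lowVerts] at hx
  exact hx.le

/-- A set of low-degree vertices, any two of which have a common low-degree neighbour, is
small. -/
theorem SimpleGraph.card_le_of_common_lowVerts {D : ℕ} {A : Finset V} (hA : A ⊆ G.lowVerts D)
    (h : ∀ x ∈ A, ∀ y ∈ A, x ≠ y → ∃ w ∈ G.lowVerts D, G.Adj x w ∧ G.Adj w y) :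
    A.card ≤ D * D + 1 := by
  obtain rfl | ⟨x, hx⟩ := A.eq_empty_or_nonempty
  · simp
  have hsub : A ⊆ insert x
      ((G.neighborFinset x ∩ G.lowVerts D).biUnion fun w => G.neighborFinset w) := by
    intro y hy
    obtain rfl | hxy := eq_or_ne x y
    · simp
    obtain ⟨w, hw, h₁, h₂⟩ := h x hx y hy hxy
    simp only [Finset.mem_insert, Finset.mem_biUnion, Finset.mem_inter, mem_neighborFinset]
    exact Or.inr ⟨w, ⟨h₁, hw⟩, h₂⟩
  refine (Finset.card_le_card hsub).trans ((Finset.card_insert_le _ _).trans ?_)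
  gcongr
  refine (Finset.card_biUnion_le_card_mul _ _ D fun w hw => ?_).trans ?_
  · simp [lowVerts] at hw
    simpa using hw.2
  · gcongr
    have := hA hx
    simp [lowVerts] at this
    exact (Finset.card_le_card Finset.inter_subset_left).trans (by simpa using this)

/-- The Hansel-type counting bound: a random choice of one colour at each vertex is respected by
all high-degree neighbours of a vertex `x` with probability `2 ^ (-d x)`, and the vertices where
this happens form a set to which `SimpleGraph.card_le_of_common_lowVerts` applies. -/
theorem sum_two_inv_pow_card_highNbrs_le {col : Sym2 V → Fin 2}
    (h : ∀ u v, u ≠ v → ∃ w, IsRainbowCherry G col u w v) (D : ℕ) :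
    ∑ x ∈ G.lowVerts D, (2 : ℝ)⁻¹ ^ (G.highNbrs D x).card ≤ D * D + 1 := by
  let good : V → Finset (V → Fin 2) := fun x =>
    Fintype.piFinset fun w => if w ∈ G.highNbrs D x then {col s(x, w)} else Finset.univ
  have hgood : ∀ x, ((good x).card : ℝ) =
      2 ^ Fintype.card V * (2 : ℝ)⁻¹ ^ (G.highNbrs D x).card := by
    intro x
    have h1 : (good x).card = ∏ w, if w ∈ G.highNbrs D x then 1 else 2 := by
      simp only [good, Fintype.card_piFinset]
      refine Finset.prod_congr rfl fun w _ => ?_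
      split_ifs <;> simp
    have h2 : ((good x).card : ℝ) = ∏ w : V, 2 * (if w ∈ G.highNbrs D x then (2 : ℝ)⁻¹ else 1) := by
      rw [h1, Nat.cast_prod]
      refine Finset.prod_congr rfl fun w _ => ?_
      split_ifs <;> norm_num
    rw [h2, Finset.prod_mul_distrib, Finset.prod_ite_mem]
    simp
  have hcount : ∑ x ∈ G.lowVerts D, (good x).card ≤ 2 ^ Fintype.card V * (D * D + 1) := by
    calc ∑ x ∈ G.lowVerts D, (good x).card
        = ∑ f : V → Fin 2, ({x ∈ G.lowVerts D | f ∈ good x} : Finset V).card := by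
          have := Finset.sum_card_bipartiteAbove_eq_sum_card_bipartiteBelow (s := G.lowVerts D)
            (t := Finset.univ) fun (x : V) (f : V → Fin 2) => f ∈ good x
          simpa [Finset.bipartiteAbove, Finset.bipartiteBelow] using this
      _ ≤ ∑ _f : V → Fin 2, (D * D + 1) := by
          refine Finset.sum_le_sum fun f _ => G.card_le_of_common_lowVerts
            (Finset.filter_subset _ _) fun x hx y hy hxy => ?_
          obtain ⟨w, hxw, hwy, hc⟩ := h x y hxy
          refine ⟨w, ?_, hxw, hwy⟩
          by_contra hw
          simp only [SimpleGraph.lowVerts, Finset.mem_filter, Finset.mem_univ, true_and,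
            not_le] at hw
          have hf : ∀ z, f ∈ good z → G.Adj z w → f w = col s(z, w) := by
            intro z hz hzw
            have := Fintype.mem_piFinset.1 hz w
            simpa [SimpleGraph.highNbrs, hzw, hw] using this
          rw [Finset.mem_filter] at hx hy
          refine hc ?_
          rw [← hf x hx.2 hxw, hf y hy.2 hwy.symm, Sym2.eq_swap]
      _ = _ := by simp
  have hcount' : ∑ x ∈ G.lowVerts D, ((good x).card : ℝ) ≤ 2 ^ Fintype.card V * (D * D + 1) := by
    exact_mod_cast hcount
  simp only [hgood, ← Finset.mul_sum] at hcount'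
  exact le_of_mul_le_mul_left hcount' (by positivity)

theorem card_lowVerts_mul_logb_le {col : Sym2 V → Fin 2}
    (h : ∀ u v, u ≠ v → ∃ w, IsRainbowCherry G col u w v) (D : ℕ) (hD : (G.lowVerts D).Nonempty) :
    (G.lowVerts D).card * Real.logb 2 ((G.lowVerts D).card / (D * D + 1)) ≤ G.edgeFinset.card := by
  refine (card_mul_logb_le_sum _ hD _ (by positivity)
    (sum_two_inv_pow_card_highNbrs_le h D)).trans ?_
  exact_mod_cast G.sum_card_highNbrs_le D

end LowerBound

open Filter Asymptotics

theorem eventually_logb_two_le_mul {c : ℝ} (hc : 0 < c) :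
    ∀ᶠ t : ℝ in atTop, Real.logb 2 t ≤ c * t := by
  have hlog : 0 < Real.log 2 := Real.log_pos one_lt_two
  filter_upwards [Real.isLittleO_log_id_atTop.bound (mul_pos hc hlog), eventually_ge_atTop 0]
    with t ht ht0
  rw [Real.logb, div_le_iff₀ hlog]
  have := (le_abs_self _).trans ht
  simp only [id, Real.norm_eq_abs, abs_of_nonneg ht0] at this
  linarith

theorem tendsto_logb_two_natCast : Tendsto (fun n : ℕ => Real.logb 2 n) atTop atTop :=
  (Real.tendsto_logb_atTop one_lt_two).comp tendsto_natCast_atTop_atTop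

theorem exists_graph_eventually {ε : ℝ} (hε : 0 < ε) :
    ∀ᶠ n : ℕ in atTop, ∃ G : SimpleGraph (Fin n), TwoConnected G ∧ rc2 G ≤ 2 ∧
      (G.edgeSet.ncard : ℝ) ≤ (1 + ε) * n * Real.logb 2 n := by
  filter_upwards [tendsto_natCast_atTop_atTop.eventually
      (eventually_logb_two_le_mul (show (0 : ℝ) < 4⁻¹ by norm_num)),
    tendsto_logb_two_natCast.eventually (eventually_ge_atTop (4 / ε)),
    eventually_ge_atTop 10] with n h₁ h₂ h₃
  have hk := Real.natLog_le_logb n 2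
  push_cast at hk
  have hn : (10 : ℝ) ≤ n := by exact_mod_cast h₃
  obtain ⟨G, hG, hrc, hcard⟩ := exists_graph_of_le_two_pow (n := n) (k := Nat.log 2 n + 1)
    (Nat.succ_pos _)
    (by
      have : (2 * (Nat.log 2 n + 1) + 3 : ℝ) ≤ n := by linarith
      exact_mod_cast this)
    (Nat.lt_pow_succ_log_self one_lt_two n).le
  refine ⟨G, hG, hrc, ?_⟩
  have hcard' : (G.edgeSet.ncard : ℝ) ≤ (Nat.log 2 n + 1 + 3) * n := by exact_mod_cast hcard
  rw [div_le_iff₀ hε] at h₂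
  calc (G.edgeSet.ncard : ℝ) ≤ (Nat.log 2 n + 1 + 3) * n := hcard'
    _ ≤ ((1 + ε) * Real.logb 2 n) * n := by gcongr; linarith
    _ = _ := by ring

theorem le_ncard_edgeSet_of_bounds {n : ℕ} {ε : ℝ} (hε : 0 < ε) (hε1 : ε ≤ 1)
    (ht : 4 / ε ≤ Real.logb 2 n)
    (hlog : 4 + 4 * Real.logb 2 (Real.logb 2 n) ≤ ε / 2 * Real.logb 2 n)
    {G : SimpleGraph (Fin n)} (hG : TwoConnected G) (hrc : rc2 G ≤ 2) :
    (1 - ε) * n * Real.logb 2 n ≤ G.edgeSet.ncard := by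
  classical
  obtain ⟨col, hcol⟩ := hG.exists_rainbowTwoConnectedColouring_rc2
  have hcherry : ∀ u v, u ≠ v → ∃ w, IsRainbowCherry G (Fin.castLE hrc ∘ col) u w v :=
    fun u v huv => (hcol.exists_isRainbowCherry hrc huv).imp fun w hw =>
      ⟨hw.1, hw.2.1, (Fin.castLE_injective hrc).ne hw.2.2⟩
  rw [← coe_edgeFinset, Set.ncard_coe_finset]
  have hn : (0 : ℝ) < n := by
    have := hG.1
    rw [Fintype.card_fin] at this
    exact_mod_cast (by omega : 0 < n)
  set t := Real.logb 2 n
  rw [div_le_iff₀ hε] at ht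
  have ht4 : 4 ≤ t := by nlinarith
  by_contra! hlt
  have hE : (G.edgeFinset.card : ℝ) ≤ n * t := by
    nlinarith [mul_pos hε (mul_pos hn (by linarith : 0 < t))]
  set D := ⌈t ^ 2⌉₊
  have hD1 : t ^ 2 ≤ D := Nat.le_ceil _
  have hD2 : (D : ℝ) ≤ t ^ 2 + 1 := (Nat.ceil_lt_add_one (by positivity)).le
  set L := G.lowVerts D
  have hLn : L.card ≤ n := by simpa using L.card_le_univ
  have hdeg : (D : ℝ) * (n - L.card) ≤ 2 * G.edgeFinset.card := by
    have := G.mul_card_sub_card_lowVerts_le D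
    rw [Fintype.card_fin] at this
    rw [← Nat.cast_sub hLn]
    exact_mod_cast this
  have hLn' : (0 : ℝ) ≤ n - L.card := sub_nonneg.2 (by exact_mod_cast hLn)
  have hdef : t * (n - L.card) ≤ 2 * n := by
    have : t * (t * (n - L.card)) ≤ t * (2 * n) := by nlinarith
    exact le_of_mul_le_mul_left this (by linarith)
  have hm : (1 - ε / 2) * n ≤ L.card := by
    have h1 : 4 * (n - L.card) ≤ (t * ε) * (n - L.card) := by gcongr
    nlinarith
  have hm2 : (n : ℝ) / 2 ≤ L.card := by nlinarith
  have hmpos : (0 : ℝ) < L.card := by linarith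
  have hK : (D : ℝ) * D + 1 ≤ 8 * t ^ 4 := by
    have h1 : (D : ℝ) ≤ 2 * t ^ 2 := by nlinarith
    have h2 : (D : ℝ) * D ≤ (2 * t ^ 2) * (2 * t ^ 2) := by gcongr
    linarith [one_le_pow₀ (n := 4) (by linarith : 1 ≤ t)]
  have hbound : t - (4 + 4 * Real.logb 2 t) ≤ Real.logb 2 (L.card / (D * D + 1)) := by
    have h1 : (n : ℝ) / (16 * t ^ 4) ≤ L.card / (D * D + 1) := by
      calc (n : ℝ) / (16 * t ^ 4) = (n / 2) / (8 * t ^ 4) := by field_simp; norm_num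
        _ ≤ _ := by gcongr
    have h2 : Real.logb 2 ((n : ℝ) / (16 * t ^ 4)) = t - (4 + 4 * Real.logb 2 t) := by
      rw [Real.logb_div hn.ne' (by positivity), Real.logb_mul (by norm_num) (by positivity),
        Real.logb_pow, show (16 : ℝ) = 2 ^ (4 : ℕ) by norm_num, Real.logb_pow,
        Real.logb_self_eq_one one_lt_two]
      push_cast
      ring
    rw [← h2]
    exact Real.logb_le_logb_of_le one_lt_two (by positivity) h1
  have hmain := card_lowVerts_mul_logb_le hcherry D
    (Finset.card_pos.1 (by exact_mod_cast hmpos))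
  have hfinal : ((1 - ε / 2) * n) * ((1 - ε / 2) * t) ≤ G.edgeFinset.card := by
    refine le_trans ?_ hmain
    have : (0 : ℝ) ≤ 1 - ε / 2 := by linarith
    gcongr
    linarith
  nlinarith [mul_nonneg (sq_nonneg (ε / 2)) (mul_nonneg hn.le (by linarith : 0 ≤ t))]

theorem le_ncard_edgeSet_eventually {ε : ℝ} (hε : 0 < ε) :
    ∀ᶠ n : ℕ in atTop, ∀ G : SimpleGraph (Fin n), TwoConnected G → rc2 G ≤ 2 →
      (1 - ε) * n * Real.logb 2 n ≤ G.edgeSet.ncard := by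
  obtain hε1 | hε1 := le_or_gt ε 1
  · filter_upwards [tendsto_logb_two_natCast.eventually
        (eventually_logb_two_le_mul (show 0 < ε / 16 by positivity)),
      tendsto_logb_two_natCast.eventually (eventually_ge_atTop (16 / ε))] with n h₁ h₂ G hG hrc
    have h₃ : 4 / ε ≤ 16 / ε := by gcongr; norm_num
    refine le_ncard_edgeSet_of_bounds hε hε1 (h₃.trans h₂) ?_ hG hrc
    rw [div_le_iff₀ hε] at h₂
    linarith
  · filter_upwards [tendsto_logb_two_natCast.eventually (eventually_ge_atTop 0)] with n h G _ _
    have h₁ : (1 - ε) * n * Real.logb 2 n ≤ 0 :=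
      mul_nonpos_of_nonpos_of_nonneg
        (mul_nonpos_of_nonpos_of_nonneg (by linarith) (Nat.cast_nonneg n)) h
    exact h₁.trans (Nat.cast_nonneg _)

/-- t₂(n,2) = (1 + o(1)) · n · log₂ n. -/
theorem stmt1 :
    ∀ ε : ℝ, 0 < ε → ∃ N : ℕ, ∀ n : ℕ, N ≤ n →
      (1 - ε) * n * Real.logb 2 n ≤ (t2 n 2 : ℝ) ∧
      (t2 n 2 : ℝ) ≤ (1 + ε) * n * Real.logb 2 n := by
  intro ε hε
  refine eventually_atTop.1 ?_
  filter_upwards [exists_graph_eventually hε, le_ncard_edgeSet_eventually hε] with n h₁ h₂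
  obtain ⟨G, hG, hrc, hcard⟩ := h₁
  have hmem : G.edgeSet.ncard ∈
      {m : ℕ | ∃ G : SimpleGraph (Fin n), TwoConnected G ∧ rc2 G ≤ 2 ∧ G.edgeSet.ncard = m} :=
    ⟨G, hG, hrc, rfl⟩
  constructor
  · obtain ⟨H, hH, hrcH, hcardH⟩ := Nat.sInf_mem ⟨_, hmem⟩
    have := h₂ H hH hrcH
    rwa [hcardH] at this
  · exact le_trans (by exact_mod_cast Nat.sInf_le hmem) hcard
end

section
/- For integers r and n with 6 ≤ r ≤ n − 3, there exists a 2-connected graph G on n vertices with |E(G)| = 2n − r + 2 and rc₂(G) ≤ r. Consequently t₂(n,r) ≤ 2n − r + 2. -/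
open SimpleGraph

namespace RainbowConstruction

section Joins

variable {V α : Type*} {G : SimpleGraph V} {col : Sym2 V → α} {u v w : V} {S S' : Set V}
  {C C' : Set α}

/-- `S` is the vertex set of a rainbow path from `u` to `v` whose colours all lie in `C`. -/
def Joins (G : SimpleGraph V) (col : Sym2 V → α) (u v : V) (S : Set V) (C : Set α) : Prop :=
  ∃ p : G.Walk u v, p.IsPath ∧ IsRainbowWalk col p ∧ (∀ x, x ∈ p.support ↔ x ∈ S) ∧
    ∀ e ∈ p.edges, col e ∈ C

lemma Joins.symm (h : Joins G col u v S C) : Joins G col v u S C := by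
  obtain ⟨p, hp, hr, hS, hC⟩ := h
  refine ⟨p.reverse, hp.reverse, ?_, by simpa using hS, by simpa using hC⟩
  simpa [IsRainbowWalk] using hr

lemma Joins.mono (h : Joins G col u v S C) (hC : C ⊆ C') : Joins G col u v S C' := by
  obtain ⟨p, hp, hr, hS, hp'⟩ := h
  exact ⟨p, hp, hr, hS, fun e he => hC (hp' e he)⟩

lemma Joins.left_mem (h : Joins G col u v S C) : u ∈ S := by
  obtain ⟨p, -, -, hS, -⟩ := h
  exact (hS u).1 p.start_mem_support

lemma Joins.right_mem (h : Joins G col u v S C) : v ∈ S := h.symm.left_mem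

lemma Joins.trans (h : Joins G col u v S C) (h' : Joins G col v w S' C')
    (hS : ∀ x ∈ S, x ∈ S' → x = v) (hC : Disjoint C C') :
    Joins G col u w (S ∪ S') (C ∪ C') := by
  obtain ⟨p, hp, hpr, hpS, hpC⟩ := h
  obtain ⟨q, hq, hqr, hqS, hqC⟩ := h'
  refine ⟨p.append q, ?_, ?_, ?_, ?_⟩
  · have hq' := hq.support_nodup
    rw [← Walk.cons_tail_support, List.nodup_cons] at hq'
    rw [Walk.isPath_def, Walk.support_append]
    refine List.nodup_append'.2 ⟨hp.support_nodup, hq'.2, fun x hx hx' => ?_⟩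
    obtain rfl := hS x ((hpS x).1 hx) ((hqS x).1 (List.mem_of_mem_tail hx'))
    exact hq'.1 hx'
  · rw [IsRainbowWalk, Walk.edges_append, List.map_append]
    refine List.nodup_append'.2 ⟨hpr, hqr, fun c hc hc' => ?_⟩
    obtain ⟨e, he, rfl⟩ := List.mem_map.1 hc
    obtain ⟨e', he', hee⟩ := List.mem_map.1 hc'
    exact Set.disjoint_left.1 hC (hpC e he) (hee ▸ hqC e' he')
  · intro x
    rw [Walk.mem_support_append_iff, hpS, hqS, Set.mem_union]
  · intro e he
    rw [Walk.edges_append, List.mem_append] at he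
    exact he.imp (hpC e) (hqC e)

lemma Joins.nil (u : V) : Joins G col u u {u} C :=
  ⟨Walk.nil, by simp, by simp [IsRainbowWalk], by simp, by simp⟩

lemma Joins.of_adj (h : G.Adj u v) : Joins G col u v {u, v} {col s(u, v)} :=
  ⟨h.toWalk, by simp [h.ne], by simp [IsRainbowWalk], by simp, by simp⟩

/-- There are two internally disjoint rainbow paths between `u` and `v`. -/
def Linked (G : SimpleGraph V) (col : Sym2 V → α) (u v : V) : Prop :=
  ∃ p q : G.Walk u v, p.IsPath ∧ q.IsPath ∧ p ≠ q ∧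
    IsRainbowWalk col p ∧ IsRainbowWalk col q ∧
    ∀ w : V, w ∈ p.support → w ∈ q.support → w = u ∨ w = v

lemma Linked.symm (h : Linked G col u v) : Linked G col v u := by
  obtain ⟨p, q, hp, hq, hpq, hpr, hqr, hd⟩ := h
  refine ⟨p.reverse, q.reverse, hp.reverse, hq.reverse,
    fun h => hpq (Walk.reverse_injective h), ?_, ?_, ?_⟩
  · simpa [IsRainbowWalk] using hpr
  · simpa [IsRainbowWalk] using hqr
  · intro w hw hw'
    exact (hd w (by simpa using hw) (by simpa using hw')).symm

lemma Joins.linked (h : Joins G col u v S C) (h' : Joins G col u v S' C')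
    (hne : ∃ x ∈ S, x ∉ S') (hS : ∀ x ∈ S, x ∈ S' → x = u ∨ x = v) :
    Linked G col u v := by
  obtain ⟨p, hp, hpr, hpS, -⟩ := h
  obtain ⟨q, hq, hqr, hqS, -⟩ := h'
  refine ⟨p, q, hp, hq, ?_, hpr, hqr, fun w hw hw' => hS w ((hpS w).1 hw) ((hqS w).1 hw')⟩
  rintro rfl
  obtain ⟨x, hx, hx'⟩ := hne
  exact hx' ((hqS x).1 ((hpS x).2 hx))

end Joins

section General

variable {V W α β : Type*} {G : SimpleGraph V}

lemma RainbowTwoConnectedColouring.twoConnected [Fintype V] {col : Sym2 V → α}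
    (h : RainbowTwoConnectedColouring G col) (hV : 3 ≤ Fintype.card V) : TwoConnected G := by
  refine ⟨hV, fun v => ?_⟩
  have : Nontrivial V := Fintype.one_lt_card_iff_nontrivial.1 (by omega)
  obtain ⟨x, hx⟩ := exists_ne v
  have : Nonempty ({v}ᶜ : Set V) := ⟨⟨x, hx⟩⟩
  refine ⟨?_⟩
  rintro ⟨a, ha⟩ ⟨b, hb⟩
  rcases eq_or_ne a b with rfl | hab
  · exact Reachable.refl _
  obtain ⟨p, q, -, -, -, -, -, hpq⟩ := h a b hab
  have key : ∀ p : G.Walk a b, v ∉ p.support →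
      (G.induce ({v}ᶜ : Set V)).Reachable ⟨a, ha⟩ ⟨b, hb⟩ := fun p hp =>
    ⟨p.induce _ fun x hx (hxv : x = v) => hp (hxv ▸ hx)⟩
  by_cases hp : v ∈ p.support
  · refine key q fun hq => ?_
    rcases hpq v hp hq with rfl | rfl
    · exact ha rfl
    · exact hb rfl
  · exact key p hp

/-- Rainbow 2-connectedness only depends on which edges have equal colours. -/
lemma RainbowTwoConnectedColouring.of_comp {col : Sym2 V → α} (f : α → β)
    (h : RainbowTwoConnectedColouring G (f ∘ col)) : RainbowTwoConnectedColouring G col := by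
  have key : ∀ {u v : V} (p : G.Walk u v), IsRainbowWalk (f ∘ col) p → IsRainbowWalk col p := by
    intro u v p hp
    rw [IsRainbowWalk, ← List.map_map] at hp
    exact hp.of_map
  intro u v huv
  obtain ⟨p, q, hp, hq, hpq, hpr, hqr, hd⟩ := h u v huv
  exact ⟨p, q, hp, hq, hpq, key p hpr, key q hqr, hd⟩

lemma RainbowTwoConnectedColouring.map_iso {H : SimpleGraph W} (e : G ≃g H) {col : Sym2 V → α}
    (h : RainbowTwoConnectedColouring G col) :
    RainbowTwoConnectedColouring H (col ∘ Sym2.map e.symm) := by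
  have hr : ∀ {u v : V} (p : G.Walk u v), IsRainbowWalk col p →
      IsRainbowWalk (col ∘ Sym2.map e.symm) (p.map e.toHom) := by
    intro u v p hp
    rw [IsRainbowWalk, Walk.edges_map, List.map_map]
    have : (col ∘ Sym2.map e.symm) ∘ Sym2.map e.toHom = col := by
      ext x
      induction x with | _ x y => simp
    rwa [this]
  intro u v huv
  obtain ⟨u, rfl⟩ := e.surjective u
  obtain ⟨v, rfl⟩ := e.surjective v
  obtain ⟨p, q, hp, hq, hpq, hpr, hqr, hd⟩ := h u v (fun h => huv (h ▸ rfl))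
  refine ⟨p.map e.toHom, q.map e.toHom, hp.map e.injective, hq.map e.injective,
    fun h => hpq (Walk.map_injective_of_injective e.injective _ _ h), hr p hpr, hr q hqr, ?_⟩
  intro w hw hw'
  obtain ⟨w, rfl⟩ := e.surjective w
  have hmem : ∀ p : G.Walk u v, e w ∈ (p.map e.toHom).support → w ∈ p.support := by
    intro p hp
    rw [Walk.support_map] at hp
    exact (List.mem_map_of_injective e.injective).1 hp
  exact (hd w (hmem p hw) (hmem q hw')).imp (congrArg e) (congrArg e)

end General

/-- The template graph: two hubs, two copies of a 4-cycle gadget (each vertex of which sees one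
hub) and three single vertices seeing both hubs. -/
inductive Template
  | hub (h : Bool)
  | cyc (c : Bool) (s : Fin 4)
  | sgl (k : Fin 3)
  deriving DecidableEq, Fintype

namespace Template

/-- The hub seen by vertex `s` of a 4-cycle gadget. -/
def hubOf (s : Fin 4) : Bool := decide (2 ≤ s.val)

/-- The colour of the edge from vertex `s` of a 4-cycle gadget to its hub. -/
def spokeColour : Fin 4 → ℕ := ![0, 2, 2, 0]

/-- The colour of the edge from `s` to `s + 1` in a 4-cycle gadget. -/
def rimColour : Fin 4 → ℕ := ![1, 3, 1, 4]

/-- The colour of the edge from the `k`-th single vertex to the hub `h`. -/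
def singleColour (k : Fin 3) (h : Bool) : ℕ := if h then ![2, 3, 1] k else ![1, 3, 2] k

/-- The colour of the edge joining two template vertices, if there is one. -/
def colour : Template → Template → Option ℕ
  | cyc c s, cyc d t =>
    if c = d then
      if t = s + 1 then some (rimColour s) else if s = t + 1 then some (rimColour t) else none
    else none
  | cyc _ s, hub h => if h = hubOf s then some (spokeColour s) else none
  | hub h, cyc _ s => if h = hubOf s then some (spokeColour s) else none
  | sgl k, hub h => some (singleColour k h)
  | hub h, sgl k => some (singleColour k h)
  | _, _ => none

/-- The second vertex is a hub or lies in the gadget of the first one. -/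
def near : Template → Template → Bool
  | _, hub _ => true
  | cyc c _, cyc d _ => c == d
  | sgl k, sgl l => k == l
  | _, _ => false

/-- All template vertices. -/
def vertices : List Template :=
  [hub false, hub true] ++ (List.finRange 4).map (cyc false) ++ (List.finRange 4).map (cyc true) ++
    (List.finRange 3).map sgl

/-- The colours of the edges joining consecutive vertices of a list. -/
def colours (l : List Template) : List ℕ := l.zipWith (fun x y => (colour x y).getD 0) l.tail

/-- `u :: l` lists the vertices of a rainbow path from `u` to `v` inside `A`. -/
def IsRainbowPath (A : Template → Bool) (u v : Template) (l : List Template) : Prop :=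
  (u :: l).IsChain (fun x y => (colour x y).isSome) ∧ (u :: l).Nodup ∧
    (u :: l).getLast? = some v ∧ (colours (u :: l)).Nodup ∧ ∀ x ∈ u :: l, A x

instance (A : Template → Bool) (u v : Template) (l : List Template) :
    Decidable (IsRainbowPath A u v l) := by
  unfold IsRainbowPath; infer_instance

/-- The candidates for `IsRainbowPath A u v`, found by depth-first search to a given depth; `seen`
and `used` list the vertices and colours that are no longer available. -/
def search (A : Template → Bool) (v : Template) :
    ℕ → Template → List Template → List ℕ → List (List Template)
  | 0, _, _, _ => []
  | n + 1, u, seen, used =>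
    if u = v then [[]] else
    vertices.flatMap fun w => match colour u w with
      | none => []
      | some c =>
        if A w && !seen.contains w && !used.contains c then
          (search A v n w (w :: seen) (c :: used)).map (w :: ·)
        else []

lemma exists_pair_search (u v : Template) (hu : ∀ h, u ≠ hub h) (hv : ∀ h, v ≠ hub h)
    (huv : u ≠ v) :
    ∃ l ∈ search (fun x => near u x || near v x) v 7 u [u] [],
    ∃ m ∈ search (fun x => near u x || near v x) v 7 u [u] [],
      IsRainbowPath (fun x => near u x || near v x) u v l ∧
      IsRainbowPath (fun x => near u x || near v x) u v m ∧
      (∃ x ∈ u :: l, x ∉ u :: m) ∧ ∀ x ∈ u :: l, x ∈ u :: m → x = u ∨ x = v := by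
  revert u v
  decide +kernel

lemma exists_fan_search (u : Template) (hu : ∀ h, u ≠ hub h) :
    ∃ l ∈ search (near u) (hub false) 5 u [u] [],
    ∃ m ∈ search (near u) (hub true) 5 u [u] [],
      IsRainbowPath (near u) u (hub false) l ∧ IsRainbowPath (near u) u (hub true) m ∧
      (∀ c ∈ colours (u :: l), c < 4) ∧ (∀ c ∈ colours (u :: m), c < 4) ∧
      ∀ x ∈ u :: l, x ∈ u :: m → x = u := by
  revert u
  decide +kernel

lemma exists_link_search :
    ∃ l ∈ search (near (cyc false 0)) (hub true) 6 (hub false) [hub false] [],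
      IsRainbowPath (near (cyc false 0)) (hub false) (hub true) l ∧
      (∀ c ∈ colours (hub false :: l), c < 4) ∧ ∃ x ∈ l, ∀ h, x ≠ hub h := by
  decide +kernel

lemma exists_walk {V : Type*} {G : SimpleGraph V} {col : Sym2 V → ℕ} {φ : Template → V}
    {A : Template → Prop}
    (hφ : ∀ x y c, A x → A y → colour x y = some c → G.Adj (φ x) (φ y) ∧ col s(φ x, φ y) = c)
    (l : List Template) (u v : Template)
    (hl : (u :: l).IsChain fun x y => (colour x y).isSome)
    (hv : (u :: l).getLast? = some v) (hA : ∀ x ∈ u :: l, A x) :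
    ∃ p : G.Walk (φ u) (φ v), p.support = (u :: l).map φ ∧
      p.edges.map col = colours (u :: l) := by
  induction l generalizing u with
  | nil =>
    obtain rfl : u = v := by simpa using hv
    exact ⟨Walk.nil, by simp, by simp [colours]⟩
  | cons w l ih =>
    rw [List.isChain_cons_cons] at hl
    obtain ⟨p, hp, hpc⟩ := ih w hl.2 (by simpa using hv)
      fun x hx => hA x (List.mem_cons_of_mem _ hx)
    obtain ⟨c, hc⟩ := Option.isSome_iff_exists.1 hl.1
    obtain ⟨hadj, hcol⟩ := hφ u w c (hA u (by simp)) (hA w (by simp)) hc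
    refine ⟨Walk.cons hadj p, by simp [hp], ?_⟩
    rw [Walk.edges_cons, List.map_cons, hpc, hcol]
    simp [colours, hc]

lemma IsRainbowPath.joins {V : Type*} {G : SimpleGraph V} {col : Sym2 V → ℕ} {φ : Template → V}
    {A : Template → Prop} {B : Template → Bool}
    (hφ : ∀ x y c, A x → A y → colour x y = some c → G.Adj (φ x) (φ y) ∧ col s(φ x, φ y) = c)
    (hinj : ∀ x y, A x → A y → φ x = φ y → x = y) (hBA : ∀ x, B x → A x)
    {u v : Template} {l : List Template} (h : IsRainbowPath B u v l) :
    Joins G col (φ u) (φ v) {w | ∃ x ∈ u :: l, φ x = w} {c | c ∈ colours (u :: l)} := by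
  obtain ⟨hc, hn, hv, hcol, hB⟩ := h
  have hA : ∀ x ∈ u :: l, A x := fun x hx => hBA x (hB x hx)
  obtain ⟨p, hp, hpc⟩ := exists_walk hφ l u v hc hv hA
  refine ⟨p, ?_, ?_, ?_, ?_⟩
  · rw [Walk.isPath_def, hp]
    exact hn.map_on fun x hx y hy hxy => hinj x y (hA x hx) (hA y hy) hxy
  · rwa [IsRainbowWalk, hpc]
  · intro w
    rw [hp, List.mem_map]
    rfl
  · intro e he
    rw [Set.mem_ofPred_eq, ← hpc]
    exact List.mem_map_of_mem he

end Template

open Template (hubOf spokeColour rimColour singleColour)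

/-- Vertices of the construction: a path of length `L` whose end vertices serve as hubs, `q` copies
of the 4-cycle gadget, and `t` single vertices. -/
inductive Vertex (L q t : ℕ)
  | path (i : Fin (L + 1))
  | cyc (i : Fin q) (s : Fin 4)
  | sgl (k : Fin t)
  deriving DecidableEq, Fintype

/-- Indices for the edges of the construction. -/
abbrev EdgeIndex (L q t : ℕ) : Type := Fin L ⊕ (Fin q × Fin 4) × Bool ⊕ Fin t × Bool

namespace Vertex

variable {L q t : ℕ}

lemma card_vertex : Fintype.card (Vertex L q t) = L + 1 + 4 * q + t := by
  let e : Vertex L q t ≃ Fin (L + 1) ⊕ (Fin q × Fin 4) ⊕ Fin t :=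
    { toFun := fun
        | path i => .inl i
        | cyc i s => .inr (.inl (i, s))
        | sgl k => .inr (.inr k)
      invFun := fun
        | .inl i => path i
        | .inr (.inl (i, s)) => cyc i s
        | .inr (.inr k) => sgl k
      left_inv := by rintro (i | ⟨i, s⟩ | k) <;> rfl
      right_inv := by rintro (i | ⟨i, s⟩ | k) <;> rfl }
  rw [Fintype.card_congr e]
  simp only [Fintype.card_sum, Fintype.card_prod, Fintype.card_fin]
  ring

/-- The two end vertices of the path. -/
def hub (h : Bool) : Vertex L q t := path (if h then Fin.last L else 0)

/-- The end vertices of an edge. -/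
def ends : EdgeIndex L q t → Sym2 (Vertex L q t)
  | .inl i => s(path i.castSucc, path i.succ)
  | .inr (.inl ((i, s), true)) => s(cyc i s, cyc i (s + 1))
  | .inr (.inl ((i, s), false)) => s(cyc i s, hub (hubOf s))
  | .inr (.inr (k, h)) => s(sgl k, hub h)

/-- The colour of an edge. -/
def edgeColour (ht : t ≤ 3) : EdgeIndex L q t → ℕ
  | .inl i => 4 + i
  | .inr (.inl ((_, s), true)) => rimColour s
  | .inr (.inl ((_, s), false)) => spokeColour s
  | .inr (.inr (k, h)) => singleColour (k.castLE ht) h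

lemma edgeColour_lt (ht : t ≤ 3) (hL : 2 ≤ L) (e : EdgeIndex L q t) :
    edgeColour ht e < 4 + L := by
  have hr : ∀ s, rimColour s < 5 := by decide
  have hs : ∀ s, spokeColour s < 5 := by decide
  have hk : ∀ k h, singleColour k h < 5 := by decide
  rcases e with i | ⟨⟨i, s⟩, _ | _⟩ | ⟨k, h⟩
  · simp [edgeColour]
  · have := hs s
    simp only [edgeColour]; omega
  · have := hr s
    simp only [edgeColour]; omega
  · have := hk (k.castLE ht) h
    simp only [edgeColour]; omega

lemma hub_injective (hL : 2 ≤ L) : Function.Injective (hub : Bool → Vertex L q t) := by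
  intro h h' hh
  rcases h with _ | _ <;> rcases h' with _ | _ <;> simp [hub, Fin.ext_iff] at hh ⊢ <;> omega

lemma ends_injective (hL : 2 ≤ L) :
    Function.Injective (ends : EdgeIndex L q t → Sym2 (Vertex L q t)) := by
  have hrim : ∀ s s' : Fin 4, s = s' + 1 → s + 1 = s' → s = s' := by decide
  rintro (i | ⟨⟨i, s⟩, _ | _⟩ | ⟨k, h⟩) (i' | ⟨⟨i', s'⟩, _ | _⟩ | ⟨k', h'⟩) hee
  case inr.inr.inr.inr =>
    have : k = k' ∧ (hub h : Vertex L q t) = hub h' := by simpa [ends, hub] using hee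
    rw [this.1, hub_injective hL this.2]
  all_goals simp [ends, hub, Fin.ext_iff] at hee ⊢
  all_goals grind

lemma ends_not_isDiag (e : EdgeIndex L q t) : ¬ (ends e).IsDiag := by
  rcases e with i | ⟨⟨i, s⟩, _ | _⟩ | ⟨k, h⟩ <;> simp [ends, hub, Fin.ext_iff]

variable (L q t) in
/-- The graph of the construction. -/
def graph : SimpleGraph (Vertex L q t) := fromEdgeSet (Set.range ends)

/-- The colouring of the construction. -/
noncomputable def colouring (ht : t ≤ 3) : Sym2 (Vertex L q t) → ℕ :=
  Function.extend ends (edgeColour ht) 0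

lemma colouring_lt (ht : t ≤ 3) (hL : 2 ≤ L) (x : Sym2 (Vertex L q t)) :
    colouring ht x < 4 + L := by
  by_cases hx : ∃ e, ends e = x
  · obtain ⟨e, rfl⟩ := hx
    rw [colouring, (ends_injective hL).extend_apply]
    exact edgeColour_lt ht hL e
  · rw [colouring, Function.extend_apply' _ _ _ hx, Pi.zero_apply]
    omega

lemma ncard_edgeSet (hL : 2 ≤ L) : (graph L q t).edgeSet.ncard = L + 8 * q + 2 * t := by
  have : (graph L q t).edgeSet = Set.range ends := by
    rw [graph, edgeSet_fromEdgeSet, sdiff_eq_left, Set.disjoint_left]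
    rintro _ ⟨e, rfl⟩
    exact ends_not_isDiag e
  rw [this, Set.ncard_range_of_injective (ends_injective hL), Nat.card_eq_fintype_card]
  simp only [EdgeIndex, Fintype.card_sum, Fintype.card_prod, Fintype.card_fin, Fintype.card_bool]
  ring

lemma adj_of_ends (hL : 2 ≤ L) (ht : t ≤ 3) {x y : Vertex L q t} (e : EdgeIndex L q t)
    (he : ends e = s(x, y)) :
    (graph L q t).Adj x y ∧ colouring ht s(x, y) = edgeColour ht e := by
  refine ⟨?_, ?_⟩
  · rw [graph, fromEdgeSet_adj]
    refine ⟨⟨e, he⟩, ?_⟩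
    rintro rfl
    exact ends_not_isDiag e (he ▸ rfl)
  · rw [← he, colouring, (ends_injective hL).extend_apply]

/-- Place the template in the construction, its 4-cycles being sent to the copies `i` and `j`. -/
def place (i j : Fin q) : Template → Vertex L q t
  | .hub h => hub h
  | .cyc c s => cyc (if c then j else i) s
  | .sgl k => if h : k.val < t then sgl ⟨k, h⟩ else hub false

/-- The part of the template on which `place i j` is faithful. -/
def Faithful (t : ℕ) (i j : Fin q) : Template → Prop
  | .hub _ => True
  | .cyc c _ => c = true → i ≠ j
  | .sgl k => k.val < t

lemma place_injOn (hL : 2 ≤ L) (i j : Fin q) (x y : Template) (hx : Faithful t i j x)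
    (hy : Faithful t i j y) (h : (place i j x : Vertex L q t) = place i j y) : x = y := by
  rcases x with b | ⟨_ | _, s⟩ | k <;> rcases y with b' | ⟨_ | _, s'⟩ | k' <;>
    simp only [Faithful] at hx hy <;> simp [place, hx, hy, hub] at h ⊢
  all_goals first | exact hub_injective (q := q) (t := t) hL (by simpa [hub] using h) | grind

lemma place_colour (hL : 2 ≤ L) (ht : t ≤ 3) (i j : Fin q) (x y : Template) (c : ℕ)
    (hx : Faithful t i j x) (hy : Faithful t i j y) (h : Template.colour x y = some c) :
    (graph L q t).Adj (place i j x) (place i j y) ∧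
      colouring ht s((place i j x : Vertex L q t), place i j y) = c := by
  rcases x with b | ⟨d, s⟩ | k <;> rcases y with b' | ⟨d', s'⟩ | k' <;>
    simp only [Template.colour, reduceCtorEq] at h
  · split_ifs at h with hb
    obtain rfl := Option.some_inj.1 h
    exact adj_of_ends hL ht (.inr (.inl ((if d' then j else i, s'), false)))
      (by simp [ends, place, hb, Sym2.eq_swap])
  · obtain rfl := Option.some_inj.1 h
    exact adj_of_ends hL ht (.inr (.inr (⟨k', hy⟩, b)))
      (by simp [ends, place, show k'.val < t from hy, Sym2.eq_swap])
  · split_ifs at h with hb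
    obtain rfl := Option.some_inj.1 h
    exact adj_of_ends hL ht (.inr (.inl ((if d then j else i, s), false)))
      (by simp [ends, place, hb])
  · split_ifs at h with hd hs hs'
    · obtain rfl := Option.some_inj.1 h
      exact adj_of_ends hL ht (.inr (.inl ((if d then j else i, s), true)))
        (by simp [ends, place, hd, hs])
    · obtain rfl := Option.some_inj.1 h
      exact adj_of_ends hL ht (.inr (.inl ((if d then j else i, s'), true)))
        (by simp [ends, place, hd, hs', Sym2.eq_swap])
  · obtain rfl := Option.some_inj.1 h
    exact adj_of_ends hL ht (.inr (.inr (⟨k, hx⟩, b')))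
      (by simp [ends, place, show k.val < t from hx])

/-- Any two vertices off the path are the images of template vertices under a placement that is
faithful on their gadgets. -/
lemma exists_place (ht : t ≤ 3) (i₀ : Fin q) (u v : Vertex L q t) (hu : ∀ i, u ≠ path i)
    (hv : ∀ i, v ≠ path i) :
    ∃ (i j : Fin q) (x y : Template), place i j x = u ∧ place i j y = v ∧
      (∀ h, x ≠ .hub h) ∧ (∀ h, y ≠ .hub h) ∧
      ∀ z, x.near z || y.near z → Faithful t i j z := by
  rcases u with i | ⟨i, s⟩ | k <;> rcases v with i' | ⟨i', s'⟩ | k'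
  · exact absurd rfl (hu i)
  · exact absurd rfl (hu i)
  · exact absurd rfl (hu i)
  · exact absurd rfl (hv i')
  · by_cases hi : i = i'
    · refine ⟨i, i, .cyc false s, .cyc false s', by simp [place], by simp [place, hi], by simp,
        by simp, ?_⟩
      rintro (h | ⟨c, r⟩ | l) <;> simp [Template.near, Faithful]
    · refine ⟨i, i', .cyc false s, .cyc true s', by simp [place], by simp [place], by simp,
        by simp, ?_⟩
      rintro (h | ⟨c, r⟩ | l) <;> simp [Template.near, Faithful, hi]
  · refine ⟨i, i, .cyc false s, .sgl (k'.castLE ht), by simp [place], by simp [place], by simp,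
      by simp, ?_⟩
    rintro (h | ⟨c, r⟩ | l) <;> simp [Template.near, Faithful]
    rintro rfl
    simp
  · exact absurd rfl (hv i')
  · refine ⟨i', i', .sgl (k.castLE ht), .cyc false s', by simp [place], by simp [place], by simp,
      by simp, ?_⟩
    rintro (h | ⟨c, r⟩ | l) <;> simp [Template.near, Faithful]
    rintro rfl
    simp
  · refine ⟨i₀, i₀, .sgl (k.castLE ht), .sgl (k'.castLE ht), by simp [place], by simp [place],
      by simp, by simp, ?_⟩
    rintro (h | ⟨c, r⟩ | l) <;> simp [Template.near, Faithful]
    rintro (rfl | rfl) <;> simp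

/-- The path vertices with index in `[i, j]`. -/
def segment (i j : ℕ) : Set (Vertex L q t) := {w | ∃ k : Fin (L + 1), i ≤ k ∧ k ≤ j ∧ w = path k}

lemma joins_segment (hL : 2 ≤ L) (ht : t ≤ 3) (i j : ℕ) (hij : i ≤ j) (hj : j < L + 1) :
    Joins (graph L q t) (colouring ht) (path ⟨i, by omega⟩) (path ⟨j, hj⟩) (segment i j)
      (Set.Ico (4 + i) (4 + j)) := by
  induction j, hij using Nat.le_induction with
  | base =>
    have : (segment i i : Set (Vertex L q t)) = {path ⟨i, by omega⟩} := by
      ext w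
      simp only [segment, Set.mem_ofPred_eq, Set.mem_singleton_iff]
      exact ⟨fun ⟨k, h, h', hw⟩ => by rw [hw]; congr 1; ext; simp; omega,
        fun h => ⟨_, le_rfl, le_rfl, h⟩⟩
    rw [this]
    exact Joins.nil _
  | succ j hij ih =>
    obtain ⟨hadj, hcol⟩ := adj_of_ends hL ht (x := path ⟨j, by omega⟩) (y := path ⟨j + 1, hj⟩)
      (.inl ⟨j, by omega⟩) rfl
    have := (ih (by omega)).trans (Joins.of_adj (col := colouring ht) hadj) ?_ ?_
    · convert this.mono (C' := Set.Ico (4 + i) (4 + (j + 1))) ?_ using 1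
      · ext w
        simp only [segment, Set.mem_ofPred_eq, Set.mem_union, Set.mem_insert_iff,
          Set.mem_singleton_iff]
        constructor
        · rintro ⟨k, hk, hk', rfl⟩
          rcases Nat.lt_or_ge j k with h | h
          · right; right
            congr 1; ext; simp; omega
          · exact .inl ⟨k, hk, h, rfl⟩
        · rintro (⟨k, hk, hk', rfl⟩ | rfl | rfl)
          · exact ⟨k, hk, by omega, rfl⟩
          · exact ⟨_, hij, by simp, rfl⟩
          · exact ⟨_, by simp; omega, by simp, rfl⟩
      · rw [hcol]
        rintro c (hc | hc)
        · exact ⟨hc.1, by have := hc.2; omega⟩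
        · rw [Set.mem_singleton_iff, edgeColour] at hc
          simp only [Set.mem_Ico]
          simp only at hc
          omega
    · rintro x ⟨k, hk, hk', rfl⟩ hx
      simp only [Set.mem_insert_iff, Set.mem_singleton_iff, path.injEq, Fin.ext_iff] at hx ⊢
      omega
    · rw [hcol, Set.disjoint_singleton_right]
      simp [edgeColour]

lemma path_mem_segment {i j : ℕ} {k : Fin (L + 1)} :
    (path k : Vertex L q t) ∈ segment i j ↔ i ≤ k ∧ k ≤ j := by
  simp [segment]

lemma place_eq_path {i j : Fin q} {x : Template} (hx : Faithful t i j x)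
    {k : Fin (L + 1)} (h : (place i j x : Vertex L q t) = path k) :
    x = .hub false ∧ k.val = 0 ∨ x = .hub true ∧ k.val = L := by
  rcases x with _ | ⟨_, s⟩ | l
  · rename_i b
    cases b <;> simp [place, hub] at h <;> simp [← h]
  · simp [place] at h
  · simp [place, show l.val < t from hx] at h

/-- From a vertex off the path there are disjoint paths to both hubs. -/
lemma exists_fan (hL : 2 ≤ L) (ht : t ≤ 3) (i₀ : Fin q) (u : Vertex L q t)
    (hu : ∀ i, u ≠ path i) :
    ∃ S T : Set (Vertex L q t), Joins (graph L q t) (colouring ht) u (hub false) S (Set.Iio 4) ∧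
      Joins (graph L q t) (colouring ht) u (hub true) T (Set.Iio 4) ∧
      (∀ k, path k ∈ S → k.val = 0) ∧ (∀ k, path k ∈ T → k.val = L) ∧
      ∀ x ∈ S, x ∈ T → x = u := by
  obtain ⟨i, j, x, y, rfl, -, hx, -, hA⟩ := exists_place ht i₀ u u hu hu
  obtain ⟨l, -, m, -, hl, hm, hlc, hmc, hlm⟩ := Template.exists_fan_search x hx
  have hA' : ∀ z, x.near z → Faithful t i j z := fun z hz => hA z (by simp [hz])
  have hlA : ∀ z ∈ x :: l, Faithful t i j z := fun z hz => hA' z (hl.2.2.2.2 z hz)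
  have hmA : ∀ z ∈ x :: m, Faithful t i j z := fun z hz => hA' z (hm.2.2.2.2 z hz)
  have hlh : .hub false ∈ x :: l := List.mem_of_getLast? hl.2.2.1
  have hmh : .hub true ∈ x :: m := List.mem_of_getLast? hm.2.2.1
  refine ⟨_, _, (hl.joins (place_colour hL ht i j) (place_injOn hL i j) hA').mono hlc,
    (hm.joins (place_colour hL ht i j) (place_injOn hL i j) hA').mono hmc, ?_, ?_, ?_⟩
  · rintro k ⟨z, hz, hzk⟩
    rcases place_eq_path (hlA z hz) hzk with ⟨-, h⟩ | ⟨rfl, -⟩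
    · exact h
    · exact absurd (hlm _ hz hmh).symm (hx _)
  · rintro k ⟨z, hz, hzk⟩
    rcases place_eq_path (hmA z hz) hzk with ⟨rfl, -⟩ | ⟨-, h⟩
    · exact absurd (hlm _ hlh hz).symm (hx _)
    · exact h
  · rintro _ ⟨y, hy, rfl⟩ ⟨z, hz, hzy⟩
    obtain rfl := place_injOn hL i j z y (hmA z hz) (hlA y hy) hzy
    rw [hlm z hy hz]

/-- There is a path between the hubs with all inner vertices off the path. -/
lemma exists_link (hL : 2 ≤ L) (ht : t ≤ 3) (i₀ : Fin q) :
    ∃ S : Set (Vertex L q t), Joins (graph L q t) (colouring ht) (hub false) (hub true) S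
      (Set.Iio 4) ∧ (∀ k, path k ∈ S → k.val = 0 ∨ k.val = L) ∧
      ∃ x ∈ S, ∀ k, x ≠ path k := by
  obtain ⟨l, -, hl, hlc, x, hxl, hx⟩ := Template.exists_link_search
  have hA : ∀ z, (Template.cyc false 0).near z → Faithful t i₀ i₀ z := by
    rintro (h | ⟨c, r⟩ | l) <;> simp [Template.near, Faithful]
  have hlA : ∀ z ∈ .hub false :: l, Faithful t i₀ i₀ z := fun z hz => hA z (hl.2.2.2.2 z hz)
  refine ⟨_, (hl.joins (place_colour hL ht i₀ i₀) (place_injOn hL i₀ i₀) hA).mono hlc, ?_,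
    place i₀ i₀ x, ⟨x, List.mem_cons_of_mem _ hxl, rfl⟩, ?_⟩
  · rintro k ⟨z, hz, hzk⟩
    exact (place_eq_path (hlA z hz) hzk).imp And.right And.right
  · intro k hk
    rcases place_eq_path (hlA x (List.mem_cons_of_mem _ hxl)) hk with ⟨h, -⟩ | ⟨h, -⟩ <;>
      exact hx _ h

lemma linked_of_off_path (hL : 2 ≤ L) (ht : t ≤ 3) (i₀ : Fin q) {u v : Vertex L q t}
    (hu : ∀ i, u ≠ path i) (hv : ∀ i, v ≠ path i) (huv : u ≠ v) :
    Linked (graph L q t) (colouring ht) u v := by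
  obtain ⟨i, j, x, y, rfl, rfl, hx, hy, hA⟩ := exists_place ht i₀ u v hu hv
  obtain ⟨l, -, m, -, hl, hm, ⟨z, hzl, hzm⟩, hlm⟩ :=
    Template.exists_pair_search x y hx hy (fun h => huv (h ▸ rfl))
  have hlA : ∀ z ∈ x :: l, Faithful t i j z := fun z hz => hA z (hl.2.2.2.2 z hz)
  have hmA : ∀ z ∈ x :: m, Faithful t i j z := fun z hz => hA z (hm.2.2.2.2 z hz)
  refine (hl.joins (place_colour hL ht i j) (place_injOn hL i j) hA).linked
    (hm.joins (place_colour hL ht i j) (place_injOn hL i j) hA) ?_ ?_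
  · refine ⟨_, ⟨z, hzl, rfl⟩, ?_⟩
    rintro ⟨w, hw, hwz⟩
    obtain rfl := place_injOn hL i j w z (hmA w hw) (hlA z hzl) hwz
    exact hzm hw
  · rintro _ ⟨z, hz, rfl⟩ ⟨w, hw, hwz⟩
    obtain rfl := place_injOn hL i j w z (hmA w hw) (hlA z hz) hwz
    exact (hlm w hz hw).imp (congrArg _) (congrArg _)

lemma linked_path_of_off_path (hL : 2 ≤ L) (ht : t ≤ 3) (i₀ : Fin q) {u : Vertex L q t}
    (hu : ∀ i, u ≠ path i) (k : Fin (L + 1)) :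
    Linked (graph L q t) (colouring ht) u (path k) := by
  obtain ⟨S, T, hS, hT, hS', hT', hST⟩ := exists_fan hL ht i₀ u hu
  have h₁ := hS.trans (joins_segment hL ht 0 k (by omega) k.2) (by
    rintro _ hx ⟨i, -, -, rfl⟩
    exact congrArg path (Fin.ext (hS' i hx))) (by
    rw [Set.disjoint_left]
    rintro c hc ⟨hc', -⟩
    rw [Set.mem_Iio] at hc
    omega)
  have h₂ := hT.trans (joins_segment hL ht k L (by omega) (by omega)).symm (by
    rintro _ hx ⟨i, -, -, rfl⟩
    exact congrArg path (Fin.ext (hT' i hx))) (by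
    rw [Set.disjoint_left]
    rintro c hc ⟨hc', -⟩
    rw [Set.mem_Iio] at hc
    omega)
  have hd : ∀ x ∈ S ∪ segment 0 k, x ∈ T ∪ segment k L → x = u ∨ x = path k := by
    rintro x (hx | ⟨i, hi, hi', rfl⟩) (hx' | ⟨j, hj, hj', hij⟩)
    · exact .inl (hST x hx hx')
    · subst hij
      have := hS' j hx
      exact .inr (congrArg path (Fin.ext (by omega)))
    · have := hT' i hx'
      exact .inr (congrArg path (Fin.ext (by omega)))
    · obtain rfl := path.inj hij
      exact .inr (congrArg path (Fin.ext (by omega)))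
  rcases Nat.lt_or_ge k L with hk | hk
  · refine h₂.linked h₁ ⟨hub true, .inl hT.right_mem, ?_⟩ fun x hx hx' => hd x hx' hx
    rintro (h | h)
    · have : L = 0 := hS' _ h
      omega
    · have : L ≤ k := (path_mem_segment.1 h).2
      omega
  · refine h₁.linked h₂ ⟨hub false, .inl hS.right_mem, ?_⟩ hd
    rintro (h | h)
    · have : 0 = L := hT' _ h
      omega
    · have : k.val ≤ 0 := (path_mem_segment.1 h).1
      omega

lemma linked_path_path (hL : 2 ≤ L) (ht : t ≤ 3) (i₀ : Fin q) {i j : Fin (L + 1)} (hij : i < j) :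
    Linked (graph L q t) (colouring ht) (path i) (path j) := by
  obtain ⟨S, hS, hS', x, hx, hxp⟩ := exists_link (t := t) hL ht i₀
  have hij' : i.val < j.val := hij
  have h₁ := (joins_segment (q := q) hL ht 0 i (by omega) i.2).symm.trans hS (by
    rintro _ ⟨k, -, hk, rfl⟩ hk'
    refine congrArg path (Fin.ext ?_)
    rcases hS' k hk' with h | h
    · exact h
    · omega) (by
    rw [Set.disjoint_left]
    rintro c ⟨hc, -⟩ hc'
    rw [Set.mem_Iio] at hc'
    omega)
  have h₂ := h₁.trans (joins_segment hL ht j L (by omega) (by omega)).symm (by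
    rintro _ hx ⟨k, hk, hk', rfl⟩
    refine congrArg path (Fin.ext ?_)
    rcases hx with hx | hx
    · have := path_mem_segment.1 hx
      omega
    · rcases hS' k hx with h | h
      · omega
      · exact h) (by
    rw [Set.disjoint_left]
    rintro c (⟨hc, hc'⟩ | hc) ⟨hc₁, -⟩
    · omega
    · rw [Set.mem_Iio] at hc
      omega)
  refine h₂.linked (joins_segment hL ht i j hij'.le j.2) ⟨x, .inl (.inr hx), ?_⟩ ?_
  · rintro ⟨k, -, -, rfl⟩
    exact hxp k rfl
  · rintro _ hx ⟨k, hk, hk', rfl⟩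
    simp only [path.injEq, Fin.ext_iff]
    rcases hx with (hx | hx) | hx
    · have := path_mem_segment.1 hx
      omega
    · have := hS' k hx
      omega
    · have := path_mem_segment.1 hx
      omega

lemma linked (hL : 2 ≤ L) (ht : t ≤ 3) (i₀ : Fin q) {u v : Vertex L q t} (huv : u ≠ v) :
    Linked (graph L q t) (colouring ht) u v := by
  by_cases hu : ∃ i, u = path i <;> by_cases hv : ∃ j, v = path j
  · obtain ⟨i, rfl⟩ := hu
    obtain ⟨j, rfl⟩ := hv
    rcases lt_or_gt_of_ne (fun h : i = j => huv (h ▸ rfl)) with h | h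
    · exact linked_path_path hL ht i₀ h
    · exact (linked_path_path hL ht i₀ h).symm
  · obtain ⟨i, rfl⟩ := hu
    exact (linked_path_of_off_path hL ht i₀ (not_exists.1 hv) i).symm
  · obtain ⟨j, rfl⟩ := hv
    exact linked_path_of_off_path hL ht i₀ (not_exists.1 hu) j
  · exact linked_of_off_path hL ht i₀ (not_exists.1 hu) (not_exists.1 hv) huv

variable (L q t) in
/-- The construction with its colours bounded by `4 + L`. -/
lemma exists_rainbowTwoConnectedColouring (hL : 2 ≤ L) (ht : t ≤ 3) (hq : 0 < q) :
    ∃ col : Sym2 (Vertex L q t) → Fin (4 + L), RainbowTwoConnectedColouring (graph L q t) col :=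
  ⟨fun x => ⟨colouring ht x, colouring_lt ht hL x⟩,
    RainbowTwoConnectedColouring.of_comp Fin.val fun _ _ huv => linked hL ht ⟨0, hq⟩ huv⟩

end Vertex

end RainbowConstruction

/-- For 6 ≤ r ≤ n − 3 there is a 2-connected graph on n vertices
with exactly 2n − r + 2 edges and rc₂ ≤ r; consequently t₂(n,r) ≤ 2n − r + 2. -/
theorem stmt8 (r n : ℕ) (hr : 6 ≤ r) (hrn : r ≤ n - 3) :
    (∃ G : SimpleGraph (Fin n), TwoConnected G ∧
      G.edgeSet.ncard = 2 * n - r + 2 ∧ rc2 G ≤ r) ∧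
    t2 n r ≤ 2 * n - r + 2 := by
  have hex : ∃ G : SimpleGraph (Fin n), TwoConnected G ∧
      G.edgeSet.ncard = 2 * n - r + 2 ∧ rc2 G ≤ r := by
    obtain ⟨L, rfl⟩ : ∃ L, r = 4 + L := ⟨r - 4, by omega⟩
    obtain ⟨q, t, hqt, ht⟩ : ∃ q t, n = L + 1 + 4 * q + t ∧ t ≤ 3 :=
      ⟨(n - (L + 1)) / 4, (n - (L + 1)) % 4, by omega, by omega⟩
    obtain ⟨col, hcol⟩ := RainbowConstruction.Vertex.exists_rainbowTwoConnectedColouring L q t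
      (by omega) ht (by omega)
    let e : RainbowConstruction.Vertex L q t ≃ Fin n :=
      Fintype.equivFinOfCardEq (RainbowConstruction.Vertex.card_vertex.trans hqt.symm)
    let f := Iso.map e (RainbowConstruction.Vertex.graph L q t)
    have hcol' := RainbowConstruction.RainbowTwoConnectedColouring.map_iso f hcol
    refine ⟨_, RainbowConstruction.RainbowTwoConnectedColouring.twoConnected hcol'
      (by rw [Fintype.card_fin]; omega), ?_, Nat.sInf_le ⟨_, hcol'⟩⟩
    have hcard := RainbowConstruction.Vertex.ncard_edgeSet (L := L) (q := q) (t := t) (by omega)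
    rw [← Nat.card_coe_set_eq] at hcard ⊢
    rw [← Nat.card_congr f.mapEdgeSet, hcard]
    omega
  refine ⟨hex, ?_⟩
  obtain ⟨G, hG, hcard, hrc⟩ := hex
  exact Nat.sInf_le ⟨G, hG, hrc, hcard⟩
end

section
/- Let n ≥ 6 and let G be a 2-connected graph on n vertices with exactly n + 1 edges (equivalently, G is a Θ-graph, consisting of three internally vertex-disjoint paths joining two vertices x and y). Then rc₂(G) ≥ n − 1; that is, G admits no rainbow 2-connected edge-colouring with at most n − 2 colours. -/
open SimpleGraph

theorem false_of_colour_constraints (ℓ : Fin 3 → ℕ) {i₀ i₁ i₂ : Fin 3} (h01 : i₀ ≠ i₁)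
    (h02 : i₀ ≠ i₂) (h12 : i₁ ≠ i₂) (h0 : 1 ≤ ℓ i₀) (h1 : 2 ≤ ℓ i₁) (h2 : 3 ≤ ℓ i₂) {α : Type*}
    (c : Fin 3 → ℕ → α)
    (hcount : ∀ i k j l, k < ℓ i → l < ℓ j → ∃ a r b s, r < ℓ a ∧ s < ℓ b ∧ ¬(a = b ∧ r = s) ∧
      ¬(a = i ∧ r = k) ∧ ¬(a = j ∧ r = l) ∧ ¬(b = i ∧ s = k) ∧ ¬(b = j ∧ s = l) ∧ c a r = c b s)
    (hcross : ∀ i k j l, i ≠ j → k < ℓ i → l < ℓ j → 2 ≤ ℓ i → 2 ≤ ℓ j → c i k = c j l →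
      (k = 0 ∧ l = ℓ j - 1) ∨ (k = ℓ i - 1 ∧ l = 0))
    (hedge : ∀ i k, k < ℓ i → ∃ j, j ≠ i ∧ ∀ a r b s, r < ℓ a → s < ℓ b →
      (a = i ∧ r ≠ k ∨ a = j) → (b = i ∧ s ≠ k ∨ b = j) → c a r = c b s → a = b ∧ r = s) :
    False := by
  have hsame : ∀ i k l, k < ℓ i → l < ℓ i → c i k = c i l → k ≠ l → ℓ i = 2 := by
    intro i k l hk hl hc hkl
    by_contra hne
    obtain ⟨m, hm, hmk, hml⟩ : ∃ m, m < ℓ i ∧ m ≠ k ∧ m ≠ l := by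
      by_cases h0 : k ≠ 0 ∧ l ≠ 0
      · exact ⟨0, by omega⟩
      by_cases h1 : k ≠ 1 ∧ l ≠ 1
      · exact ⟨1, by omega⟩
      · exact ⟨2, by omega⟩
    obtain ⟨j, hj, H⟩ := hedge i m hm
    exact hkl (H i k i l hk hl (Or.inl ⟨rfl, hmk.symm⟩) (Or.inl ⟨rfl, hml.symm⟩) hc).2
  have hrigid : ∀ i k j l, k < ℓ i → l < ℓ j → 2 ≤ ℓ i → 2 ≤ ℓ j → ¬(i = j ∧ k = l) →
      c i k = c j l → (k = 0 ∧ l = ℓ j - 1) ∨ (k = ℓ i - 1 ∧ l = 0) := by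
    intro i k j l hk hl hi hj hne hc
    by_cases hij : i = j
    · subst hij
      have := hsame i k l hk hl hc (by tauto)
      omega
    · exact hcross i k j l hij hk hl hi hj hc
  have hall : ∀ a : Fin 3, a = i₀ ∨ a = i₁ ∨ a = i₂ := by omega
  have hxy : ∀ i, 2 ≤ ℓ i → c i 0 = c i (ℓ i - 1) → ℓ i = 2 := fun i hi hc =>
    hsame i 0 (ℓ i - 1) (by omega) (by omega) hc (by omega)
  by_cases h0' : 2 ≤ ℓ i₀
  · have h2' : ∀ a, 2 ≤ ℓ a := by
      intro a
      rcases hall a with rfl | rfl | rfl <;> omega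
    have hmatch : ∀ i j k, i ≠ j → i ≠ k → j ≠ k → ∃ m, c i 0 = c m (ℓ m - 1) := by
      intro i j k hij hik hjk
      obtain ⟨a, r, b, s, hr, hs, hne, h⟩ := hcount j 0 k 0 (by have := h2' j; omega) (by have := h2' k; omega)
      have hR := hrigid a r b s hr hs (h2' a) (h2' b) hne h.2.2.2.2
      rcases hR with ⟨rfl, rfl⟩ | ⟨rfl, rfl⟩
      · obtain rfl : a = i := by omega
        exact ⟨b, h.2.2.2.2⟩
      · obtain rfl : b = i := by omega
        exact ⟨a, h.2.2.2.2.symm⟩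
    obtain ⟨m₀, hm₀⟩ := hmatch i₀ i₁ i₂ h01 h02 h12
    obtain ⟨m₁, hm₁⟩ := hmatch i₁ i₀ i₂ h01.symm h12 h02
    obtain ⟨m₂, hm₂⟩ := hmatch i₂ i₀ i₁ h02.symm h12.symm h01
    have hx : ∀ i j, i ≠ j → c i 0 ≠ c j 0 := by
      intro i j hij hc
      have hi := h2' i
      have hj := h2' j
      have := hcross i 0 j 0 hij (by omega) (by omega) hi hj hc
      omega
    obtain ⟨j, hj, H⟩ := hedge i₂ 1 (by omega)
    have hb : ∀ a b, (a = i₂ ∨ a = j) → (b = i₂ ∨ b = j) → c a 0 ≠ c b (ℓ b - 1) := by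
      intro a b ha hb hc
      have hbl := h2' b
      have hal := h2' a
      have hbl' : b = i₂ → 3 ≤ ℓ b := by rintro rfl; exact h2
      have := H a 0 b (ℓ b - 1) (by omega) (by omega) (by omega) (by omega) hc
      omega
    have hj' : ∃ mj, c j 0 = c mj (ℓ mj - 1) := by
      rcases hall j with rfl | rfl | rfl
      exacts [⟨_, hm₀⟩, ⟨_, hm₁⟩, ⟨_, hm₂⟩]
    obtain ⟨mj, hmj⟩ := hj'
    have k1 : ¬(m₂ = i₂ ∨ m₂ = j) := fun h => hb i₂ m₂ (Or.inl rfl) h hm₂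
    have k2 : ¬(mj = i₂ ∨ mj = j) := fun h => hb j mj (Or.inr rfl) h hmj
    have k3 : m₂ = mj := by omega
    exact hx j i₂ hj (by rw [hmj, hm₂, k3])
  · have hℓ : ℓ i₀ = 1 := by omega
    have hge : ∀ a, a ≠ i₀ → 2 ≤ ℓ a := by
      intro a ha
      rcases hall a with rfl | rfl | rfl <;> omega
    have hmatch : ∀ i j, i ≠ i₀ → j ≠ i₀ → i ≠ j → ∃ m, m ≠ i₀ ∧ c i 0 = c m (ℓ m - 1) := by
      intro i j hi hj hij
      have := hge j hj
      obtain ⟨a, r, b, s, hr, hs, hne, h⟩ := hcount i₀ 0 j 0 (by omega) (by omega)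
      have ha : a ≠ i₀ := by rintro rfl; omega
      have hb : b ≠ i₀ := by rintro rfl; omega
      rcases hrigid a r b s hr hs (hge a ha) (hge b hb) hne h.2.2.2.2 with ⟨rfl, rfl⟩ | ⟨rfl, rfl⟩
      · obtain rfl : a = i := by omega
        exact ⟨b, hb, h.2.2.2.2⟩
      · obtain rfl : b = i := by omega
        exact ⟨a, ha, h.2.2.2.2.symm⟩
    obtain ⟨m₁, hm₁, hc₁⟩ := hmatch i₁ i₂ h01.symm h02.symm h12
    obtain ⟨m₂, hm₂, hc₂⟩ := hmatch i₂ i₁ h02.symm h01.symm h12.symm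
    have hx : c i₁ 0 ≠ c i₂ 0 := by
      intro hc
      have := hcross i₁ 0 i₂ 0 h12 (by omega) (by omega) (by omega) (by omega) hc
      omega
    have hm₂' : m₂ = i₁ := by
      by_contra hm
      obtain rfl : m₂ = i₂ := by omega
      have := hxy m₂ (by omega) hc₂
      omega
    subst hm₂'
    have hm₁' : m₁ = i₂ := by
      by_contra hm
      obtain rfl : m₁ = m₂ := by omega
      exact hx (hc₁.trans hc₂.symm)
    subst hm₁'
    have hchord : ∀ i j, i ≠ i₀ → j ≠ i₀ → i ≠ j → 3 ≤ ℓ i → c i 0 = c j (ℓ j - 1) →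
        c j 0 = c i (ℓ i - 1) → ∀ r, r < ℓ i → c i₀ 0 ≠ c i r := by
      intro i j hi hj hij hi3 hc hc' r hr hcr
      have hj2 := hge j hj
      by_cases hr0 : r = 0
      · obtain ⟨m, hm, H⟩ := hedge i (ℓ i - 1) (by omega)
        by_cases hmi : m = i₀
        · exact hi (H i₀ 0 i r (by omega) hr (by omega) (by omega) hcr).1.symm
        · exact hij (H i 0 j (ℓ j - 1) (by omega) (by omega) (by omega) (by omega) hc).1
      · obtain ⟨m, hm, H⟩ := hedge i 0 (by omega)
        by_cases hmi : m = i₀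
        · exact hi (H i₀ 0 i r (by omega) hr (by omega) (by omega) hcr).1.symm
        · exact hij (H j 0 i (ℓ i - 1) (by omega) (by omega) (by omega) (by omega) hc').1.symm
    have hc2 := hchord m₁ m₂ hm₁ hm₂ h12.symm h2 hc₂ hc₁
    have hc1 : ∀ r, r < ℓ m₂ → c i₀ 0 ≠ c m₂ r := by
      by_cases h3 : 3 ≤ ℓ m₂
      · exact hchord m₂ m₁ hm₂ hm₁ h12 h3 hc₁ hc₂
      · intro r hr
        by_cases hr0 : r = 0
        · rw [hr0, hc₁]
          exact hc2 _ (by omega)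
        · obtain rfl : r = ℓ m₂ - 1 := by omega
          rw [← hc₂]
          exact hc2 _ (by omega)
    have hchord' : ∀ a r, r < ℓ a → a ≠ i₀ → c i₀ 0 ≠ c a r := by
      intro a r hr ha
      rcases hall a with rfl | rfl | rfl
      exacts [absurd rfl ha, hc1 r hr, hc2 r hr]
    obtain ⟨a, r, b, s, hr, hs, hne, h⟩ := hcount m₂ 0 m₁ 0 (by omega) (by omega)
    by_cases ha : a = i₀
    · subst ha
      obtain rfl : r = 0 := by omega
      by_cases hb : b = a
      · subst hb
        omega
      · exact hchord' b s hs hb h.2.2.2.2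
    · by_cases hb : b = i₀
      · subst hb
        obtain rfl : s = 0 := by omega
        exact hchord' a r hr ha h.2.2.2.2.symm
      · have := hrigid a r b s hr hs (hge a ha) (hge b hb) hne h.2.2.2.2
        omega

namespace SimpleGraph

variable {V : Type*} {G : SimpleGraph V} {x y : V}

/-- Three internally disjoint paths from `x` to `y`, at most one of which is a single edge. -/
structure IsTheta (p : Fin 3 → G.Walk x y) : Prop where
  ne : x ≠ y
  isPath : ∀ i, (p i).IsPath
  disjoint : ∀ i j, i ≠ j → ∀ w, w ∈ (p i).support → w ∈ (p j).support → w = x ∨ w = y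
  one_lt_length : ∀ i j, i ≠ j → 1 < (p i).length ∨ 1 < (p j).length

namespace IsTheta

variable {p : Fin 3 → G.Walk x y}

theorem reverse (h : IsTheta p) : IsTheta fun i => (p i).reverse where
  ne := h.ne.symm
  isPath i := (h.isPath i).reverse
  disjoint i j hij w hi hj := by
    simp only [Walk.support_reverse, List.mem_reverse] at hi hj
    exact (h.disjoint i j hij w hi hj).symm
  one_lt_length i j hij := by simpa using h.one_lt_length i j hij

theorem length_pos (h : IsTheta p) (i : Fin 3) : 0 < (p i).length := by
  rw [Nat.pos_iff_ne_zero]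
  exact fun h0 => h.ne (Walk.eq_of_length_eq_zero h0)

theorem getVert_inj (h : IsTheta p) {i j : Fin 3} {k l : ℕ} (hk : k ≤ (p i).length)
    (hl : l ≤ (p j).length) (he : (p i).getVert k = (p j).getVert l) :
    (i = j ∧ k = l) ∨ (k = 0 ∧ l = 0) ∨ (k = (p i).length ∧ l = (p j).length) := by
  by_cases hij : i = j
  · subst hij
    exact Or.inl ⟨rfl, (h.isPath i).getVert_injOn hk hl he⟩
  · right
    have hx := (h.isPath i).getVert_eq_start_iff hk
    have hx' := (h.isPath j).getVert_eq_start_iff hl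
    have hy := (h.isPath i).getVert_eq_end_iff hk
    have hy' := (h.isPath j).getVert_eq_end_iff hl
    rcases h.disjoint i j hij _ ((p i).getVert_mem_support k)
      (he ▸ (p j).getVert_mem_support l) with hw | hw
    · exact Or.inl ⟨hx.1 hw, hx'.1 (he ▸ hw)⟩
    · exact Or.inr ⟨hy.1 hw, hy'.1 (he ▸ hw)⟩

theorem edge_inj (h : IsTheta p) {i j : Fin 3} {k l : ℕ} (hk : k < (p i).length)
    (hl : l < (p j).length)
    (he : s((p i).getVert k, (p i).getVert (k + 1)) = s((p j).getVert l, (p j).getVert (l + 1))) :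
    i = j ∧ k = l := by
  have hlen := h.one_lt_length i j
  rw [Sym2.eq_iff] at he
  rcases he with ⟨h1, h2⟩ | ⟨h1, h2⟩
  · have h1 := h.getVert_inj hk.le hl.le h1
    have h2 := h.getVert_inj hk hl h2
    by_cases hij : i = j
    · subst hij
      omega
    · omega
  · have h1 := h.getVert_inj hk.le hl h1
    have h2 := h.getVert_inj hk hl.le h2
    omega

theorem exists_getVert_edge {i : Fin 3} {e : Sym2 V} (he : e ∈ (p i).edges) :
    ∃ k < (p i).length, s((p i).getVert k, (p i).getVert (k + 1)) = e := by
  induction e with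
  | _ a b => exact (p i).mk_mem_edges_iff_exists.1 he

/-- The lengths of the paths add up to the number of edges. -/
theorem sum_length [Finite V] (h : IsTheta p) (hc : ∀ e ∈ G.edgeSet, ∃ i, e ∈ (p i).edges) :
    Nat.card (Σ i, Fin (p i).length) = G.edgeSet.ncard := by
  rw [← Nat.card_coe_set_eq]
  refine Nat.card_congr (Equiv.ofBijective
    (fun a => ⟨s((p a.1).getVert a.2, (p a.1).getVert (a.2 + 1)),
      (p a.1).adj_getVert_succ a.2.2⟩) ⟨?_, ?_⟩)
  · rintro ⟨i, k⟩ ⟨j, l⟩ he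
    obtain ⟨rfl, hkl⟩ := h.edge_inj k.2 l.2 (Subtype.ext_iff.1 he)
    rw [Fin.ext hkl]
  · rintro ⟨e, he⟩
    obtain ⟨i, hi⟩ := hc e he
    obtain ⟨k, hk, rfl⟩ := exists_getVert_edge hi
    exact ⟨⟨i, k, hk⟩, rfl⟩

theorem exists_boundary_edge (hc : ∀ e ∈ G.edgeSet, ∃ i, e ∈ (p i).edges) {u v : V}
    (w : G.Walk u v) (S : Set V) (huv : ¬(u ∈ S ↔ v ∈ S)) :
    ∃ i k, k < (p i).length ∧ s((p i).getVert k, (p i).getVert (k + 1)) ∈ w.edges ∧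
      ¬((p i).getVert k ∈ S ↔ (p i).getVert (k + 1) ∈ S) := by
  have key : ∃ a b, s(a, b) ∈ w.edges ∧ ¬(a ∈ S ↔ b ∈ S) := by
    by_cases hu : u ∈ S
    · obtain ⟨d, hd, h1, h2⟩ := w.exists_boundary_dart S hu (by tauto)
      exact ⟨d.fst, d.snd, List.mem_map_of_mem hd, by tauto⟩
    · obtain ⟨d, hd, h1, h2⟩ := w.exists_boundary_dart Sᶜ hu (by simp; tauto)
      exact ⟨d.fst, d.snd, List.mem_map_of_mem hd, by simp at h1 h2; tauto⟩
  obtain ⟨a, b, hab, hS⟩ := key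
  obtain ⟨i, hi⟩ := hc _ (w.edges_subset_edgeSet hab)
  obtain ⟨k, hk, he⟩ := exists_getVert_edge hi
  refine ⟨i, k, hk, he ▸ hab, ?_⟩
  rcases Sym2.eq_iff.1 he with ⟨rfl, rfl⟩ | ⟨rfl, rfl⟩ <;> tauto

/-- A walk that enters or leaves an inner segment of one of the paths uses one of the two edges
bounding this segment. -/
theorem mem_edges_of_segment (h : IsTheta p) (hc : ∀ e ∈ G.edgeSet, ∃ i, e ∈ (p i).edges)
    {u v : V} (w : G.Walk u v) {i : Fin 3} {k k' : ℕ} (hk' : k' < (p i).length)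
    (huv : ¬((∃ r, k < r ∧ r ≤ k' ∧ (p i).getVert r = u) ↔
      (∃ r, k < r ∧ r ≤ k' ∧ (p i).getVert r = v))) :
    s((p i).getVert k, (p i).getVert (k + 1)) ∈ w.edges ∨
      s((p i).getVert k', (p i).getVert (k' + 1)) ∈ w.edges := by
  have hmem : ∀ j r, r ≤ (p j).length →
      ((∃ r', k < r' ∧ r' ≤ k' ∧ (p i).getVert r' = (p j).getVert r) ↔
        i = j ∧ k < r ∧ r ≤ k') := by
    refine fun j r hr => ⟨?_, ?_⟩
    · rintro ⟨r', h1, h2, he⟩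
      have := h.getVert_inj (by omega) hr he
      omega
    · rintro ⟨rfl, h1, h2⟩
      exact ⟨r, h1, h2, rfl⟩
  obtain ⟨j, r, hr, he, hS⟩ := exists_boundary_edge hc w
    {z | ∃ r, k < r ∧ r ≤ k' ∧ (p i).getVert r = z} huv
  simp only [Set.mem_ofPred_eq, hmem j r hr.le, hmem j (r + 1) hr] at hS
  obtain rfl : i = j := by tauto
  obtain rfl | rfl : r = k ∨ r = k' := by omega
  exacts [Or.inl he, Or.inr he]

/-- A walk that separates the initial segments of the paths from the final ones uses an edge
leaving one of these initial segments. -/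
theorem exists_mem_edges_of_initial (h : IsTheta p)
    (hc : ∀ e ∈ G.edgeSet, ∃ i, e ∈ (p i).edges) {u v : V} (w : G.Walk u v) (K : Fin 3 → ℕ)
    (hK : ∀ i, K i < (p i).length)
    (huv : ¬((∃ i, ∃ r ≤ K i, (p i).getVert r = u) ↔ (∃ i, ∃ r ≤ K i, (p i).getVert r = v))) :
    ∃ i, s((p i).getVert (K i), (p i).getVert (K i + 1)) ∈ w.edges := by
  have hmem : ∀ j r, r ≤ (p j).length →
      ((∃ i, ∃ r' ≤ K i, (p i).getVert r' = (p j).getVert r) ↔ r ≤ K j) := by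
    refine fun j r hr => ⟨?_, fun h1 => ⟨j, r, h1, rfl⟩⟩
    rintro ⟨i, r', h1, he⟩
    have hi := hK i
    rcases h.getVert_inj (by omega) hr he with ⟨rfl, rfl⟩ | h2 | h2 <;> omega
  obtain ⟨j, r, hr, he, hS⟩ := exists_boundary_edge hc w
    {z | ∃ i, ∃ r ≤ K i, (p i).getVert r = z} huv
  simp only [Set.mem_ofPred_eq, hmem j r hr.le, hmem j (r + 1) hr] at hS
  obtain rfl : r = K j := by omega
  exact ⟨j, he⟩

end IsTheta

/-- Distinct internally disjoint paths have no common edge. -/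
theorem Walk.IsPath.notMem_edges_of_internally_disjoint {u v : V} {P Q : G.Walk u v}
    (hP : P.IsPath) (hQ : Q.IsPath) (hne : P ≠ Q)
    (hd : ∀ w, w ∈ P.support → w ∈ Q.support → w = u ∨ w = v) {e : Sym2 V}
    (heP : e ∈ P.edges) : e ∉ Q.edges := by
  intro heQ
  induction e with
  | _ a b =>
    have hab := (P.adj_of_mem_edges heP).ne
    have ha := hd a (P.fst_mem_support_of_mem_edges heP) (Q.fst_mem_support_of_mem_edges heQ)
    have hb := hd b (P.snd_mem_support_of_mem_edges heP) (Q.snd_mem_support_of_mem_edges heQ)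
    have he : s(a, b) = s(u, v) := by
      rw [Sym2.eq_iff]
      grind
    rw [he] at heP heQ
    exact hne ((hP.eq_adj_toWalk_of_mem_edges heP).trans
      (hQ.eq_adj_toWalk_of_mem_edges heQ).symm)

end SimpleGraph

theorem IsRainbowWalk.eq_of_colour_eq {V α : Type*} {G : SimpleGraph V} {u v : V}
    {col : Sym2 V → α} {w : G.Walk u v} (hw : IsRainbowWalk col w) {e f : Sym2 V}
    (he : e ∈ w.edges) (hf : f ∈ w.edges) (hef : col e = col f) : e = f :=
  List.inj_on_of_nodup_map hw he hf hef

namespace SimpleGraph.IsTheta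

variable {V α : Type*} {G : SimpleGraph V} {x y : V} {p : Fin 3 → G.Walk x y} {col : Sym2 V → α}

theorem colour_ne_of_lt (h : IsTheta p) (hc : ∀ e ∈ G.edgeSet, ∃ i, e ∈ (p i).edges)
    (hcol : RainbowTwoConnectedColouring G col) {i j : Fin 3} (hij : i ≠ j) {s t k l : ℕ}
    (hs : s < (p i).length) (ht : t < (p j).length) (hk : k < s) (hl : l < t) :
    col s((p i).getVert k, (p i).getVert (k + 1)) ≠
      col s((p j).getVert l, (p j).getVert (l + 1)) := by
  intro hkl
  obtain ⟨P, Q, hP, hQ, hne, hrP, hrQ, hd⟩ := hcol ((p i).getVert s) ((p j).getVert t) (by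
    intro he
    have := h.getVert_inj hs.le ht.le he
    omega)
  have hi : ∀ w : G.Walk ((p i).getVert s) ((p j).getVert t),
      s((p i).getVert s, (p i).getVert (s + 1)) ∉ w.edges → ∀ k < s,
      s((p i).getVert k, (p i).getVert (k + 1)) ∈ w.edges := by
    intro w hw k hk
    refine (h.mem_edges_of_segment hc w hs (k := k) fun hiff => ?_).resolve_right hw
    obtain ⟨r, h1, h2, h3⟩ := hiff.1 ⟨s, hk, le_rfl, rfl⟩
    have := h.getVert_inj (by omega) ht.le h3
    omega
  have hj : ∀ w : G.Walk ((p i).getVert s) ((p j).getVert t),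
      s((p j).getVert t, (p j).getVert (t + 1)) ∉ w.edges → ∀ l < t,
      s((p j).getVert l, (p j).getVert (l + 1)) ∈ w.edges := by
    intro w hw l hl
    refine (h.mem_edges_of_segment hc w ht (k := l) fun hiff => ?_).resolve_right hw
    obtain ⟨r, h1, h2, h3⟩ := hiff.2 ⟨t, hl, le_rfl, rfl⟩
    have := h.getVert_inj (by omega) hs.le h3
    omega
  have hxi : ∀ w : G.Walk ((p i).getVert s) ((p j).getVert t),
      s((p i).getVert s, (p i).getVert (s + 1)) ∉ w.edges → x ∈ w.support := fun w hw => by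
    simpa using w.fst_mem_support_of_mem_edges (hi w hw 0 (by omega))
  have hxj : ∀ w : G.Walk ((p i).getVert s) ((p j).getVert t),
      s((p j).getVert t, (p j).getVert (t + 1)) ∉ w.edges → x ∈ w.support := fun w hw => by
    simpa using w.fst_mem_support_of_mem_edges (hj w hw 0 (by omega))
  have hx : ¬(x ∈ P.support ∧ x ∈ Q.support) := by
    rintro ⟨h1, h2⟩
    rcases hd x h1 h2 with h3 | h3
    · have := ((h.isPath i).getVert_eq_start_iff hs.le).1 h3.symm
      omega
    · have := ((h.isPath j).getVert_eq_start_iff ht.le).1 h3.symm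
      omega
  have hboth : ∀ w : G.Walk ((p i).getVert s) ((p j).getVert t), IsRainbowWalk col w →
      s((p i).getVert s, (p i).getVert (s + 1)) ∉ w.edges →
      s((p j).getVert t, (p j).getVert (t + 1)) ∉ w.edges → False := fun w hw h1 h2 =>
    hij (h.edge_inj (by omega) (by omega)
      (hw.eq_of_colour_eq (hi w h1 k hk) (hj w h2 l hl) hkl)).1
  have hsep := fun e he => hP.notMem_edges_of_internally_disjoint hQ hne hd (e := e) he
  have h1 := hsep s((p i).getVert s, (p i).getVert (s + 1))
  have h2 := hsep s((p j).getVert t, (p j).getVert (t + 1))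
  by_cases hiP : s((p i).getVert s, (p i).getVert (s + 1)) ∈ P.edges
  · by_cases hjP : s((p j).getVert t, (p j).getVert (t + 1)) ∈ P.edges
    · exact hboth Q hrQ (h1 hiP) (h2 hjP)
    · exact hx ⟨hxj P hjP, hxi Q (h1 hiP)⟩
  · by_cases hjP : s((p j).getVert t, (p j).getVert (t + 1)) ∈ P.edges
    · exact hx ⟨hxi P hiP, hxj Q (h2 hjP)⟩
    · exact hboth P hrP hiP hjP

theorem eq_ends_of_colour_eq (h : IsTheta p) (hc : ∀ e ∈ G.edgeSet, ∃ i, e ∈ (p i).edges)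
    (hcol : RainbowTwoConnectedColouring G col) {i j : Fin 3} (hij : i ≠ j) {k l : ℕ}
    (hk : k < (p i).length) (hl : l < (p j).length) (hi : 2 ≤ (p i).length)
    (hj : 2 ≤ (p j).length)
    (hkl : col s((p i).getVert k, (p i).getVert (k + 1)) =
      col s((p j).getVert l, (p j).getVert (l + 1))) :
    (k = 0 ∧ l = (p j).length - 1) ∨ (k = (p i).length - 1 ∧ l = 0) := by
  have h1 : ∀ s t, ¬(s < (p i).length ∧ t < (p j).length ∧ k < s ∧ l < t) :=
    fun s t ⟨hs, ht, hks, hlt⟩ => h.colour_ne_of_lt hc hcol hij hs ht hks hlt hkl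
  have h2 : ∀ s t, ¬(0 < s ∧ 0 < t ∧ s ≤ k ∧ t ≤ l) := by
    rintro s t ⟨hs, ht, hsk, htl⟩
    refine h.reverse.colour_ne_of_lt (s := (p i).length - s) (t := (p j).length - t)
      (k := (p i).length - 1 - k) (l := (p j).length - 1 - l) ?_ hcol hij ?_ ?_ ?_ ?_ ?_
    · simpa using hc
    · simp; omega
    · simp; omega
    · omega
    · omega
    · simp only [Walk.getVert_reverse]
      rw [show (p i).length - ((p i).length - 1 - k) = k + 1 by omega,
        show (p i).length - ((p i).length - 1 - k + 1) = k by omega,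
        show (p j).length - ((p j).length - 1 - l) = l + 1 by omega,
        show (p j).length - ((p j).length - 1 - l + 1) = l by omega]
      simpa only [Sym2.eq_swap] using hkl
  have h3 := h1 (k + 1) (l + 1)
  have h4 := h1 (k + 1) ((p j).length - 1)
  have h5 := h1 ((p i).length - 1) (l + 1)
  have h6 := h2 1 1
  have h7 := h2 k l
  omega

/-- For each edge, one of the two cycles through it is rainbow after deletion of this edge. -/
theorem exists_rainbow_cycle (h : IsTheta p) (hc : ∀ e ∈ G.edgeSet, ∃ i, e ∈ (p i).edges)
    (hcol : RainbowTwoConnectedColouring G col) {i : Fin 3} {k : ℕ} (hk : k < (p i).length) :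
    ∃ j, j ≠ i ∧ ∀ a r b s, r < (p a).length → s < (p b).length →
      (a = i ∧ r ≠ k ∨ a = j) → (b = i ∧ s ≠ k ∨ b = j) →
      col s((p a).getVert r, (p a).getVert (r + 1)) =
        col s((p b).getVert s, (p b).getVert (s + 1)) → a = b ∧ r = s := by
  obtain ⟨P, Q, hP, hQ, hne, hrP, hrQ, hd⟩ := hcol _ _ ((p i).adj_getVert_succ hk).ne
  obtain ⟨w, hw, hwk⟩ : ∃ w : G.Walk ((p i).getVert k) ((p i).getVert (k + 1)),
      IsRainbowWalk col w ∧ s((p i).getVert k, (p i).getVert (k + 1)) ∉ w.edges := by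
    by_cases hmem : s((p i).getVert k, (p i).getVert (k + 1)) ∈ P.edges
    · exact ⟨Q, hrQ, hP.notMem_edges_of_internally_disjoint hQ hne hd hmem⟩
    · exact ⟨P, hrP, hmem⟩
  have hi : ∀ r, r < (p i).length → r ≠ k →
      s((p i).getVert r, (p i).getVert (r + 1)) ∈ w.edges := by
    intro r hr hrk
    rcases Nat.lt_or_gt_of_ne hrk with hlt | hlt
    · refine (h.mem_edges_of_segment hc w hk (k := r) fun hiff => ?_).resolve_right hwk
      obtain ⟨r', h1, h2, h3⟩ := hiff.1 ⟨k, hlt, le_rfl, rfl⟩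
      have := h.getVert_inj (by omega) hk h3
      omega
    · refine (h.mem_edges_of_segment hc w hr (k := k) fun hiff => ?_).resolve_left hwk
      obtain ⟨r', h1, h2, h3⟩ := hiff.2 ⟨k + 1, by omega, hlt, rfl⟩
      have := h.getVert_inj (by omega) hk.le h3
      omega
  have hcut : ∀ K : Fin 3 → ℕ, (∀ a, K a < (p a).length) → K i = k →
      ∃ a, a ≠ i ∧ s((p a).getVert (K a), (p a).getVert (K a + 1)) ∈ w.edges := by
    intro K hK hKi
    obtain ⟨a, ha⟩ := h.exists_mem_edges_of_initial hc w K hK fun hiff => by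
      obtain ⟨b, r, h1, h2⟩ := hiff.1 ⟨i, k, hKi.ge, rfl⟩
      have hb := hK b
      rcases h.getVert_inj (by omega) hk h2 with ⟨rfl, h3⟩ | h3 | h3 <;> omega
    refine ⟨a, ?_, ha⟩
    rintro rfl
    exact hwk (hKi ▸ ha)
  have hj : ∃ j, j ≠ i ∧ ∀ r, r < (p j).length →
      s((p j).getVert r, (p j).getVert (r + 1)) ∈ w.edges := by
    by_contra! hcon
    choose! K hK hK' using hcon
    obtain ⟨a, ha, hmem⟩ := hcut (fun a => if a = i then k else K a) (by
      intro a
      split_ifs with hai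
      · exact hai ▸ hk
      · exact hK a hai) (if_pos rfl)
    rw [if_neg ha] at hmem
    exact hK' a ha hmem
  obtain ⟨j, hji, hj⟩ := hj
  have hmem : ∀ a r, r < (p a).length → (a = i ∧ r ≠ k ∨ a = j) →
      s((p a).getVert r, (p a).getVert (r + 1)) ∈ w.edges := by
    rintro a r hr (⟨rfl, hrk⟩ | rfl)
    exacts [hi r hr hrk, hj r hr]
  exact ⟨j, hji, fun a r b s hr hs ha hb he =>
    h.edge_inj hr hs (hw.eq_of_colour_eq (hmem a r hr ha) (hmem b s hs hb) he)⟩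

theorem not_rainbowTwoConnectedColouring [Finite V] (h : IsTheta p)
    (hc : ∀ e ∈ G.edgeSet, ∃ i, e ∈ (p i).edges) {m : ℕ} (hm : 7 ≤ m)
    (hE : G.edgeSet.ncard = m) (col : Sym2 V → Fin (m - 3)) :
    ¬RainbowTwoConnectedColouring G col := by
  intro hcol
  have hcard := h.sum_length hc
  have hsum : (p 0).length + (p 1).length + (p 2).length = m := by
    simpa [Fin.sum_univ_three, hE] using hcard
  obtain ⟨i₀, i₁, i₂, h01, h02, h12, h1, h2⟩ : ∃ i₀ i₁ i₂ : Fin 3, i₀ ≠ i₁ ∧ i₀ ≠ i₂ ∧ i₁ ≠ i₂ ∧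
      2 ≤ (p i₁).length ∧ 3 ≤ (p i₂).length := by
    have h01 := h.one_lt_length 0 1 (by decide)
    have h02 := h.one_lt_length 0 2 (by decide)
    have h12 := h.one_lt_length 1 2 (by decide)
    by_cases h0 : 3 ≤ (p 0).length
    · by_cases h1 : 2 ≤ (p 1).length
      · exact ⟨2, 1, 0, by decide, by decide, by decide, h1, h0⟩
      · exact ⟨1, 2, 0, by decide, by decide, by decide, by omega, h0⟩
    · by_cases h1 : 3 ≤ (p 1).length
      · by_cases h2 : 2 ≤ (p 2).length
        · exact ⟨0, 2, 1, by decide, by decide, by decide, h2, h1⟩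
        · exact ⟨2, 0, 1, by decide, by decide, by decide, by omega, h1⟩
      · by_cases h2 : 2 ≤ (p 1).length
        · exact ⟨0, 1, 2, by decide, by decide, by decide, h2, by omega⟩
        · exact ⟨1, 0, 2, by decide, by decide, by decide, by omega, by omega⟩
  refine false_of_colour_constraints (fun i => (p i).length) h01 h02 h12 (h.length_pos i₀) h1 h2
    (fun i k => col s((p i).getVert k, (p i).getVert (k + 1))) ?_
    (fun i k j l hij hk hl hi hj => h.eq_ends_of_colour_eq hc hcol hij hk hl hi hj)
    (fun i k hk => h.exists_rainbow_cycle hc hcol hk)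
  intro i k j l hk hl
  classical
  let S : Finset (Σ i, Fin (p i).length) := Finset.univ \ {⟨i, k, hk⟩, ⟨j, l, hl⟩}
  have hS : m - 2 ≤ S.card := by
    have h3 := Finset.le_card_sdiff
      ({⟨i, k, hk⟩, ⟨j, l, hl⟩} : Finset (Σ i, Fin (p i).length)) Finset.univ
    rw [Finset.card_univ, ← Nat.card_eq_fintype_card, hcard, hE] at h3
    have h4 := Finset.card_le_two (a := (⟨i, k, hk⟩ : Σ i, Fin (p i).length)) (b := ⟨j, l, hl⟩)
    exact (by omega : m - 2 ≤ _).trans h3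
  obtain ⟨⟨a, r⟩, ha, ⟨b, s⟩, hb, hne, heq⟩ := Finset.exists_ne_map_eq_of_card_lt_of_maps_to
    (t := (Finset.univ : Finset (Fin (m - 3)))) (s := S)
    (f := fun e => col s((p e.1).getVert e.2, (p e.1).getVert (e.2 + 1)))
    (by rw [Finset.card_univ, Fintype.card_fin]; omega) (fun _ _ => Finset.mem_univ _)
  simp only [S, Finset.mem_sdiff, Finset.mem_univ, true_and, Finset.mem_insert,
    Finset.mem_singleton, not_or] at ha hb
  refine ⟨a, r, b, s, r.2, s.2, ?_, ?_, ?_, ?_, ?_, heq⟩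
  · rintro ⟨rfl, hrs⟩
    exact hne (by rw [Fin.ext hrs])
  · rintro ⟨rfl, rfl⟩
    exact ha.1 rfl
  · rintro ⟨rfl, rfl⟩
    exact ha.2 rfl
  · rintro ⟨rfl, rfl⟩
    exact hb.1 rfl
  · rintro ⟨rfl, rfl⟩
    exact hb.2 rfl

end SimpleGraph.IsTheta

namespace TwoConnected

variable {V : Type*} [Fintype V] {G : SimpleGraph V}

theorem exists_isPath_notMem (hG : TwoConnected G) {u v z : V} (hu : u ≠ z) (hv : v ≠ z) :
    ∃ P : G.Walk u v, P.IsPath ∧ z ∉ P.support := by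
  classical
  obtain ⟨w⟩ := (hG.2 z).preconnected ⟨u, hu⟩ ⟨v, hv⟩
  refine ⟨(w.map (Embedding.induce _).toHom).bypass, Walk.bypass_isPath _, fun hz => ?_⟩
  have hz : z ∈ (w.map (Embedding.induce ({z}ᶜ : Set V)).toHom).support :=
    Walk.support_bypass_subset_support _ hz
  rw [Walk.support_map, List.mem_map] at hz
  obtain ⟨a, -, ha⟩ := hz
  exact a.2 ha

theorem exists_ne_ne_s11 (hG : TwoConnected G) (u v : V) : ∃ z, z ≠ u ∧ z ≠ v := by
  classical
  obtain ⟨z, hz⟩ := Finset.exists_mem_notMem_of_card_lt_card (s := {u, v}) (t := Finset.univ)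
    (Finset.card_le_two.trans_lt hG.1)
  exact ⟨z, by simpa using hz⟩

theorem exists_adj_ne (hG : TwoConnected G) {v z : V} (hv : v ≠ z) : ∃ w, G.Adj v w ∧ w ≠ z := by
  obtain ⟨w, hwv, hwz⟩ := hG.exists_ne_ne_s11 v z
  obtain ⟨P, -, hz⟩ := hG.exists_isPath_notMem hv hwz
  have hnil : ¬P.Nil := Walk.not_nil_of_ne hwv.symm
  refine ⟨P.snd, P.adj_snd hnil, fun he => hz (he ▸ P.getVert_mem_support 1)⟩

theorem two_le_degree (hG : TwoConnected G) [DecidableRel G.Adj] (v : V) : 2 ≤ G.degree v := by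
  classical
  obtain ⟨u, hu, -⟩ := hG.exists_ne_ne_s11 v v
  obtain ⟨a, ha, -⟩ := hG.exists_adj_ne hu.symm
  obtain ⟨b, hb, hba⟩ := hG.exists_adj_ne ha.ne
  rw [← G.card_neighborFinset_eq_degree, ← Finset.card_pair hba]
  apply Finset.card_le_card
  simp [Finset.insert_subset_iff, ha, hb]

/-- A vertex of degree at least three is an end of a theta subgraph. -/
theorem exists_isTheta (hG : TwoConnected G) {x n₁ n₂ n₃ : V} (h₁ : G.Adj x n₁)
    (h₂ : G.Adj x n₂) (h₃ : G.Adj x n₃) (h₁₂ : n₁ ≠ n₂) (h₁₃ : n₁ ≠ n₃) (h₂₃ : n₂ ≠ n₃) :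
    ∃ y, ∃ p : Fin 3 → G.Walk x y, IsTheta p := by
  classical
  obtain ⟨R, hR, hxR⟩ := hG.exists_isPath_notMem h₁.ne' h₂.ne'
  obtain ⟨Q, hQ, hxQ⟩ := hG.exists_isPath_notMem h₃.ne' h₁.ne'
  obtain ⟨y, hyR, hyQ, hfirst⟩ := Q.exists_mem_support_forall_mem_support_imp_eq R.support.toFinset
    ⟨n₁, by simp⟩
  rw [List.mem_toFinset] at hyR
  have hyx : x ≠ y := fun h => hxR (h ▸ hyR)
  have hx₁ : x ∉ (R.takeUntil y hyR).support := fun h => hxR (R.support_takeUntil_subset_support _ h)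
  have hx₂ : x ∉ (R.dropUntil y hyR).support := fun h => hxR (R.support_dropUntil_subset_support _ h)
  have hx₃ : x ∉ (Q.takeUntil y hyQ).support := fun h => hxQ (Q.support_takeUntil_subset_support _ h)
  have hd₁₂ : ∀ w, w ∈ (R.takeUntil y hyR).support → w ∈ (R.dropUntil y hyR).support → w = y := by
    intro w hw₁ hw₂
    have hnodup := hR.support_nodup
    rw [← R.take_spec hyR, Walk.support_append, List.nodup_append'] at hnodup
    rw [← Walk.cons_tail_support, List.mem_cons] at hw₂
    exact hw₂.resolve_right fun h => hnodup.2.2 hw₁ h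
  have hd₁₃ : ∀ w, w ∈ (R.takeUntil y hyR).support → w ∈ (Q.takeUntil y hyQ).support → w = y :=
    fun w hw₁ hw₃ => hfirst w (by simpa using R.support_takeUntil_subset_support _ hw₁) hw₃
  have hd₂₃ : ∀ w, w ∈ (R.dropUntil y hyR).support → w ∈ (Q.takeUntil y hyQ).support → w = y :=
    fun w hw₂ hw₃ => hfirst w (by simpa using R.support_dropUntil_subset_support _ hw₂) hw₃
  let p₁ : G.Walk x y := Walk.cons h₁ (R.takeUntil y hyR)
  let p₂ : G.Walk x y := Walk.cons h₂ (R.dropUntil y hyR).reverse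
  let p₃ : G.Walk x y := Walk.cons h₃ (Q.takeUntil y hyQ)
  have hlen : ∀ {a b : V} (w : G.Walk a b), 0 < w.length ∨ a = b := fun w => by
    rcases Nat.eq_zero_or_pos w.length with h | h
    exacts [Or.inr (Walk.eq_of_length_eq_zero h), Or.inl h]
  have l₁ := hlen (R.takeUntil y hyR)
  have l₂ := hlen (R.dropUntil y hyR).reverse
  have l₃ := hlen (Q.takeUntil y hyQ)
  refine ⟨y, ![p₁, p₂, p₃], hyx, ?_, ?_, ?_⟩
  · intro i
    fin_cases i
    · exact (Walk.cons_isPath_iff _ _).2 ⟨hR.takeUntil _, hx₁⟩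
    · exact (Walk.cons_isPath_iff _ _).2 ⟨(hR.dropUntil _).reverse, by simpa using hx₂⟩
    · exact (Walk.cons_isPath_iff _ _).2 ⟨hQ.takeUntil _, hx₃⟩
  · intro i j hij w hi hj
    by_cases hwx : w = x
    · exact Or.inl hwx
    right
    fin_cases i <;> fin_cases j <;> simp [p₁, p₂, p₃, hwx] at hij hi hj
    · exact hd₁₂ w hi hj
    · exact hd₁₃ w hi hj
    · exact hd₁₂ w hj hi
    · exact hd₂₃ w hi hj
    · exact hd₁₃ w hj hi
    · exact hd₂₃ w hj hi
  · have l₁₂ : 1 < p₁.length ∨ 1 < p₂.length := by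
      simp only [p₁, p₂, Walk.length_cons]
      by_contra! hcon
      exact h₁₂ ((l₁.resolve_left (by omega)).trans (l₂.resolve_left (by omega)).symm)
    have l₁₃ : 1 < p₁.length ∨ 1 < p₃.length := by
      simp only [p₁, p₃, Walk.length_cons]
      by_contra! hcon
      exact h₁₃ ((l₁.resolve_left (by omega)).trans (l₃.resolve_left (by omega)).symm)
    have l₂₃ : 1 < p₂.length ∨ 1 < p₃.length := by
      simp only [p₂, p₃, Walk.length_cons]
      by_contra! hcon
      exact h₂₃ ((l₂.resolve_left (by omega)).trans (l₃.resolve_left (by omega)).symm)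
    intro i j hij
    fin_cases i <;> fin_cases j
    exacts [(hij rfl).elim, l₁₂, l₁₃, l₁₂.symm, (hij rfl).elim, l₂₃, l₁₃.symm, l₂₃.symm,
      (hij rfl).elim]

end TwoConnected

namespace SimpleGraph.IsTheta

variable {V : Type*} {G : SimpleGraph V} {x y : V} {p : Fin 3 → G.Walk x y}

theorem snd_injective (h : IsTheta p) : Function.Injective fun i => (p i).getVert 1 := by
  intro i j hij
  have := h.getVert_inj (h.length_pos i) (h.length_pos j) hij
  have := h.one_lt_length i j
  omega

theorem edge_mem (p : Fin 3 → G.Walk x y) {i : Fin 3} {k : ℕ} (hk : k < (p i).length) :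
    s((p i).getVert k, (p i).getVert (k + 1)) ∈ (p i).edges :=
  ((p i).mk_mem_edges_iff_exists).2 ⟨k, hk, rfl⟩

theorem three_le_degree [Fintype V] [DecidableRel G.Adj] (h : IsTheta p) : 3 ≤ G.degree x := by
  classical
  have hcard := Finset.card_image_of_injective Finset.univ h.snd_injective
  rw [Finset.card_univ, Fintype.card_fin] at hcard
  rw [← hcard, ← G.card_neighborFinset_eq_degree]
  apply Finset.card_le_card
  simp only [Finset.image_subset_iff, mem_neighborFinset]
  intro i _
  simpa using (p i).adj_getVert_succ (h.length_pos i)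

theorem exists_mem_edges_of_degree_eq_three [Fintype V] [DecidableRel G.Adj] (h : IsTheta p)
    (hx : G.degree x = 3) {w : V} (hw : G.Adj x w) : ∃ i, s(x, w) ∈ (p i).edges := by
  classical
  have hcard := Finset.card_image_of_injective Finset.univ h.snd_injective
  rw [Finset.card_univ, Fintype.card_fin] at hcard
  have hsub : Finset.univ.image (fun i => (p i).getVert 1) = G.neighborFinset x := by
    apply Finset.eq_of_subset_of_card_le
    · simp only [Finset.image_subset_iff, mem_neighborFinset]
      intro i _
      simpa using (p i).adj_getVert_succ (h.length_pos i)
    · rw [hcard, G.card_neighborFinset_eq_degree, hx]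
  rw [← mem_neighborFinset, ← hsub] at hw
  obtain ⟨i, -, rfl⟩ := Finset.mem_image.1 hw
  exact ⟨i, by simpa using edge_mem p (h.length_pos i)⟩

theorem exists_mem_edges_of_degree_eq_two [Fintype V] [DecidableRel G.Adj] (h : IsTheta p)
    {i : Fin 3} {k : ℕ} (hk : k + 1 < (p i).length) (hdeg : G.degree ((p i).getVert (k + 1)) = 2)
    {w : V} (hw : G.Adj ((p i).getVert (k + 1)) w) :
    s((p i).getVert (k + 1), w) ∈ (p i).edges := by
  classical
  have hne : (p i).getVert k ≠ (p i).getVert (k + 1 + 1) := fun he => by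
    have := h.getVert_inj (by omega) hk he
    omega
  have hsub : {(p i).getVert k, (p i).getVert (k + 1 + 1)} =
      G.neighborFinset ((p i).getVert (k + 1)) := by
    apply Finset.eq_of_subset_of_card_le
    · simp only [Finset.insert_subset_iff, Finset.singleton_subset_iff, mem_neighborFinset]
      exact ⟨((p i).adj_getVert_succ (by omega)).symm, (p i).adj_getVert_succ hk⟩
    · rw [Finset.card_pair hne, G.card_neighborFinset_eq_degree, hdeg]
  rw [← mem_neighborFinset, ← hsub, Finset.mem_insert, Finset.mem_singleton] at hw
  rcases hw with rfl | rfl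
  · rw [Sym2.eq_swap]
    exact edge_mem p (by omega)
  · exact edge_mem p hk

/-- In a 2-connected graph with one more edge than vertices, a theta subgraph is spanning. -/
theorem spanning [Fintype V] (h : IsTheta p) (hG : TwoConnected G)
    (hE : G.edgeSet.ncard = Fintype.card V + 1) :
    (∀ v, ∃ i, v ∈ (p i).support) ∧ ∀ e ∈ G.edgeSet, ∃ i, e ∈ (p i).edges := by
  classical
  have hx3 := h.three_le_degree
  have hy3 := h.reverse.three_le_degree
  have hdeg : ∀ v, G.degree v = 2 + (if v = x then 1 else 0) + (if v = y then 1 else 0) := by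
    have hle : ∀ v ∈ Finset.univ,
        2 + (if v = x then 1 else 0) + (if v = y then 1 else 0) ≤ G.degree v := by
      intro v _
      have h2 := hG.two_le_degree v
      have hne := h.ne
      split_ifs with h1 h3 h3
      · exact (hne (h1.symm.trans h3)).elim
      · rw [h1]; omega
      · rw [h3]; omega
      · omega
    have hsum : ∑ v, (2 + (if v = x then 1 else 0) + (if v = y then 1 else 0)) =
        ∑ v, G.degree v := by
      rw [← coe_edgeFinset, Set.ncard_coe_finset] at hE
      rw [G.sum_degrees_eq_twice_card_edges, hE]
      simp [Finset.sum_add_distrib]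
      ring
    exact fun v => ((Finset.sum_eq_sum_iff_of_le hle).1 hsum v (Finset.mem_univ v)).symm
  have hxy := h.ne
  have hclosed : ∀ v w, (∃ i, v ∈ (p i).support) → G.Adj v w → ∃ i, s(v, w) ∈ (p i).edges := by
    rintro v w ⟨i, hi⟩ hvw
    obtain ⟨k, rfl, hk⟩ := Walk.mem_support_iff_exists_getVert.1 hi
    by_cases hvx : (p i).getVert k = x
    · rw [hvx] at hvw ⊢
      exact h.exists_mem_edges_of_degree_eq_three (by simp [hdeg, hxy]) hvw
    by_cases hvy : (p i).getVert k = y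
    · rw [hvy] at hvw ⊢
      simpa using h.reverse.exists_mem_edges_of_degree_eq_three (by simp [hdeg, hxy.symm]) hvw
    obtain ⟨k, rfl⟩ := Nat.exists_eq_succ_of_ne_zero (n := k) fun h0 => hvx (by simp [h0])
    have hk' : k + 1 < (p i).length := lt_of_le_of_ne hk fun hl => hvy (by simp [hl])
    exact ⟨i, h.exists_mem_edges_of_degree_eq_two hk' (by simp [hdeg, hvx, hvy]) hvw⟩
  have hcover : ∀ v, ∃ i, v ∈ (p i).support := by
    intro v
    obtain ⟨z, hzx, hzv⟩ := hG.exists_ne_ne_s11 x v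
    obtain ⟨w, -, -⟩ := hG.exists_isPath_notMem hzx.symm hzv.symm
    by_contra hv
    obtain ⟨d, -, h1, h2⟩ := w.exists_boundary_dart {v | ∃ i, v ∈ (p i).support}
      ⟨0, (p 0).start_mem_support⟩ hv
    obtain ⟨i, hi⟩ := hclosed _ _ h1 d.adj
    exact h2 ⟨i, (p i).snd_mem_support_of_mem_edges hi⟩
  refine ⟨hcover, fun e he => ?_⟩
  induction e with
  | _ a b => exact hclosed a b (hcover a) he

end SimpleGraph.IsTheta

theorem TwoConnected.exists_spanning_isTheta {V : Type*} [Fintype V] {G : SimpleGraph V}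
    (hG : TwoConnected G) (hE : G.edgeSet.ncard = Fintype.card V + 1) :
    ∃ x y, ∃ p : Fin 3 → G.Walk x y, IsTheta p ∧ (∀ v, ∃ i, v ∈ (p i).support) ∧
      ∀ e ∈ G.edgeSet, ∃ i, e ∈ (p i).edges := by
  classical
  obtain ⟨x, hx⟩ : ∃ x, 2 < G.degree x := by
    by_contra! hcon
    have hsum := Finset.sum_le_card_nsmul Finset.univ (fun v => G.degree v) 2 fun v _ => hcon v
    rw [← coe_edgeFinset, Set.ncard_coe_finset] at hE
    rw [G.sum_degrees_eq_twice_card_edges, hE, Finset.card_univ, smul_eq_mul] at hsum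
    omega
  rw [← G.card_neighborFinset_eq_degree, Finset.two_lt_card] at hx
  obtain ⟨a, ha, b, hb, c, hc, hab, hac, hbc⟩ := hx
  rw [mem_neighborFinset] at ha hb hc
  obtain ⟨y, p, hp⟩ := hG.exists_isTheta ha hb hc hab hac hbc
  exact ⟨x, y, p, hp, hp.spanning hG hE⟩

theorem SimpleGraph.Walk.IsCycle.exists_internally_disjoint {V : Type*} {G : SimpleGraph V}
    {u v : V} {c : G.Walk u u} (hc : c.IsCycle) (hv : v ∈ c.support) (huv : u ≠ v) :
    ∃ P Q : G.Walk u v, P.IsPath ∧ Q.IsPath ∧ P ≠ Q ∧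
      ∀ w, w ∈ P.support → w ∈ Q.support → w = u ∨ w = v := by
  classical
  have hspec := c.take_spec hv
  have hc' := hc
  rw [← hspec] at hc'
  have hQ := hc'.isPath_of_append_right (Walk.not_nil_of_ne huv)
  refine ⟨c.takeUntil v hv, (c.dropUntil v hv).reverse, hc.isPath_takeUntil hv, hQ.reverse, ?_, ?_⟩
  · intro he
    have hdisj := hc.isTrail.disjoint_edges_takeUntil_dropUntil hv
    rw [he, Walk.edges_reverse, List.disjoint_reverse_left] at hdisj
    have hnil := List.eq_nil_iff_forall_not_mem.2 fun e h => hdisj h h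
    rw [Walk.edges_eq_nil] at hnil
    exact huv hnil.eq.symm
  · intro w h1 h2
    have hnodup := hc'.support_nodup
    rw [Walk.tail_support_append, List.nodup_append'] at hnodup
    rw [Walk.support_reverse, List.mem_reverse, ← Walk.cons_tail_support, List.mem_cons] at h2
    rw [← Walk.cons_tail_support, List.mem_cons] at h1
    by_contra! hcon
    exact hnodup.2.2 (h1.resolve_left hcon.1) (h2.resolve_left hcon.2)

theorem SimpleGraph.IsTheta.exists_internally_disjoint {V : Type*} {G : SimpleGraph V} {x y : V}
    {p : Fin 3 → G.Walk x y} (h : IsTheta p) (hcover : ∀ v, ∃ i, v ∈ (p i).support) {u v : V}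
    (huv : u ≠ v) :
    ∃ P Q : G.Walk u v, P.IsPath ∧ Q.IsPath ∧ P ≠ Q ∧
      ∀ w, w ∈ P.support → w ∈ Q.support → w = u ∨ w = v := by
  classical
  have hcycle : ∀ i j, i ≠ j → ((p i).append (p j).reverse).IsCycle := by
    intro i j hij
    refine (h.isPath i).isCycle_append (h.isPath j).reverse ?_ (by
      simpa using h.one_lt_length i j hij)
    intro w h1 h2
    have hi := (h.isPath i).support_nodup
    have hj := (h.isPath j).reverse.support_nodup
    rw [← Walk.cons_tail_support, List.nodup_cons] at hi hj
    rcases h.disjoint i j hij w (List.mem_of_mem_tail h1)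
      (by simpa using List.mem_of_mem_tail h2) with rfl | rfl
    exacts [hi.1 h1, hj.1 h2]
  obtain ⟨i, j, hij, hu, hv⟩ : ∃ i j, i ≠ j ∧ (u ∈ (p i).support ∨ u ∈ (p j).support) ∧
      (v ∈ (p i).support ∨ v ∈ (p j).support) := by
    obtain ⟨i, hi⟩ := hcover u
    obtain ⟨j, hj⟩ := hcover v
    by_cases hij : i = j
    · subst hij
      exact ⟨i, i + 1, by omega, Or.inl hi, Or.inl hj⟩
    · exact ⟨i, j, hij, Or.inl hi, Or.inr hj⟩
  have hu' : u ∈ ((p i).append (p j).reverse).support := by simpa [Walk.mem_support_append_iff]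
  have hv' : v ∈ ((p i).append (p j).reverse).support := by simpa [Walk.mem_support_append_iff]
  exact ((hcycle i j hij).rotate hu').exists_internally_disjoint
    ((Walk.mem_support_rotate_iff _ _ hu').2 hv') huv

theorem RainbowTwoConnectedColouring.comp_injective {V α β : Type*} {G : SimpleGraph V}
    {col : Sym2 V → α} (hcol : RainbowTwoConnectedColouring G col) {f : α → β}
    (hf : Function.Injective f) : RainbowTwoConnectedColouring G (f ∘ col) := by
  intro u v huv
  obtain ⟨P, Q, hP, hQ, hne, hrP, hrQ, hd⟩ := hcol u v huv
  refine ⟨P, Q, hP, hQ, hne, ?_, ?_, hd⟩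
  · simpa [IsRainbowWalk] using List.Nodup.map hf hrP
  · simpa [IsRainbowWalk] using List.Nodup.map hf hrQ

/-- For n ≥ 6, every 2-connected graph on n vertices with exactly
n + 1 edges (a Θ-graph) satisfies rc₂(G) ≥ n − 1; equivalently, it admits no
rainbow 2-connected colouring with at most n − 2 colours. -/
theorem stmt11 (n : ℕ) (hn : 6 ≤ n) {V : Type*} [Fintype V] (hcard : Fintype.card V = n)
    (G : SimpleGraph V) (hG : TwoConnected G) (hE : G.edgeSet.ncard = n + 1) :
    n - 1 ≤ rc2 G ∧
    ∀ col : Sym2 V → Fin (n - 2), ¬ RainbowTwoConnectedColouring G col := by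
  obtain ⟨x, y, p, hp, hcover, hedges⟩ := hG.exists_spanning_isTheta (hcard ▸ hE)
  have hno : ∀ col : Sym2 V → Fin (n - 2), ¬RainbowTwoConnectedColouring G col :=
    hp.not_rainbowTwoConnectedColouring hedges (by omega) hE
  refine ⟨le_csInf ?_ ?_, hno⟩
  · classical
    refine ⟨Fintype.card (Sym2 V), Fintype.equivFin _, fun u v huv => ?_⟩
    obtain ⟨P, Q, hP, hQ, hne, hd⟩ := hp.exists_internally_disjoint hcover huv
    exact ⟨P, Q, hP, hQ, hne, hP.isTrail.edges_nodup.map (Equiv.injective _),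
      hQ.isTrail.edges_nodup.map (Equiv.injective _), hd⟩
  · rintro r ⟨col, hcol⟩
    by_contra hr
    exact hno _ (hcol.comp_injective (Fin.castLE_injective (by omega : r ≤ n - 2)))
end
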